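/- arXiv:math/0508146 — 8 statements merged into one kernel-verified Lean document; each statement's English description precedes it below -/
import Mathlib

section
/- Let G be a subgroup of the Baer–Specker group ℤ^ℕ. The following are equivalent: (1) G is Menger-bounded; (2) for each strictly increasing h : ℕ → ℕ there is f : ℕ → ℕ such that for every g ∈ G there exists n with |g(i)| ≤ f(n) for all i < h(n); (3) for each strictly increasing h : ℕ → ℕ there is f : ℕ → ℕ such that for every g ∈ G there exist infinitely many n with |g(i)| ≤ f(n) for all i < h(n); (4) there is f : ℕ → ℕ such that for every g ∈ G there exist infinitely many n with |g(i)| ≤ f(n) for all i < n. -/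
open Filter Set Topology Pointwise

def MengerBounded (G : Type*) [AddGroup G] [TopologicalSpace G] : Prop :=
  ∀ U : ℕ → Set G, (∀ n, U n ∈ nhds (0 : G)) →
    ∃ F : ℕ → Finset G, ∀ g : G, ∃ n, g ∈ (F n : Set G) + U n

def ScheepersBounded (G : Type*) [AddGroup G] [TopologicalSpace G] : Prop :=
  ∀ U : ℕ → Set G, (∀ n, U n ∈ nhds (0 : G)) →
    ∃ F : ℕ → Finset G, ∀ E : Finset G, ∃ n, (E : Set G) ⊆ (F n : Set G) + U n

def HurewiczBounded (G : Type*) [AddGroup G] [TopologicalSpace G] : Prop :=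
  ∀ U : ℕ → Set G, (∀ n, U n ∈ nhds (0 : G)) →
    ∃ F : ℕ → Finset G, ∀ g : G, ∀ᶠ n in atTop, g ∈ (F n : Set G) + U n

def RothbergerBounded (G : Type*) [AddGroup G] [TopologicalSpace G] : Prop :=
  ∀ U : ℕ → Set G, (∀ n, U n ∈ nhds (0 : G)) →
    ∃ a : ℕ → G, ∀ g : G, ∃ n, g ∈ ({a n} : Set G) + U n

def HasMenger (X : Type*) [TopologicalSpace X] : Prop :=
  ∀ U : ℕ → Set (Set X), (∀ n, ∀ u ∈ U n, IsOpen u) → (∀ n, ⋃₀ U n = univ) →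
    ∃ F : ℕ → Set (Set X), (∀ n, (F n).Finite ∧ F n ⊆ U n) ∧ ⋃ n, ⋃₀ F n = univ

def HasScheepers (X : Type*) [TopologicalSpace X] : Prop :=
  ∀ U : ℕ → Set (Set X), (∀ n, ∀ u ∈ U n, IsOpen u) → (∀ n, ⋃₀ U n = univ) →
    ∃ F : ℕ → Set (Set X), (∀ n, (F n).Finite ∧ F n ⊆ U n) ∧
      ∀ E : Set X, E.Finite → ∃ n, E ⊆ ⋃₀ F n

def HasHurewicz (X : Type*) [TopologicalSpace X] : Prop :=
  ∀ U : ℕ → Set (Set X), (∀ n, ∀ u ∈ U n, IsOpen u) → (∀ n, ⋃₀ U n = univ) →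
    ∃ F : ℕ → Set (Set X), (∀ n, (F n).Finite ∧ F n ⊆ U n) ∧
      ∀ x : X, ∀ᶠ n in atTop, x ∈ ⋃₀ F n

def HasRothberger (X : Type*) [TopologicalSpace X] : Prop :=
  ∀ U : ℕ → Set (Set X), (∀ n, ∀ u ∈ U n, IsOpen u) → (∀ n, ⋃₀ U n = univ) →
    ∃ u : ℕ → Set X, (∀ n, u n ∈ U n) ∧ ⋃ n, u n = univ

def MengerBddSet (Y : Set (ℕ → ℤ)) : Prop :=
  ∃ f : ℕ → ℕ, ∀ y ∈ Y, ∃ᶠ n in atTop, ∀ i < n, |y i| ≤ (f n : ℤ)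

def ScheepersBddSet (Y : Set (ℕ → ℤ)) : Prop :=
  ∃ f : ℕ → ℕ, ∀ F : Finset (ℕ → ℤ), (F : Set (ℕ → ℤ)) ⊆ Y →
    ∃ᶠ n in atTop, ∀ y ∈ F, ∀ i < n, y i ≤ (f n : ℤ)

def HurewiczBddSet (Y : Set (ℕ → ℤ)) : Prop :=
  ∃ f : ℕ → ℕ, ∀ y ∈ Y, ∀ᶠ n in atTop, |y n| ≤ (f n : ℤ)

def RothbergerBddSet (Y : Set (ℕ → ℤ)) : Prop :=
  ∀ h : ℕ → ℕ, StrictMono h → ∃ φ : (n : ℕ) → Fin (h n) → ℤ,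
    ∀ y ∈ Y, ∃ n, ∀ i : Fin (h n), y i.val = φ n i

noncomputable def frakb : Cardinal :=
  sInf {c : Cardinal | ∃ B : Set (ℕ → ℕ),
    (∀ g : ℕ → ℕ, ∃ f ∈ B, ¬ ∀ᶠ n in atTop, f n ≤ g n) ∧ Cardinal.mk ↥B = c}

noncomputable def frakd : Cardinal :=
  sInf {c : Cardinal | ∃ D : Set (ℕ → ℕ),
    (∀ g : ℕ → ℕ, ∃ f ∈ D, ∀ᶠ n in atTop, g n ≤ f n) ∧ Cardinal.mk ↥D = c}

noncomputable def covMeager : Cardinal :=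
  sInf {c : Cardinal | ∃ Y : Set (ℕ → ℕ),
    (¬ ∃ f : ℕ → ℕ, ∀ y ∈ Y, ∃ n, f n = y n) ∧ Cardinal.mk ↥Y = c}

open Classical in
noncomputable def specDist (x y : ℕ → ℤ) : ℝ :=
  if x = y then 0 else 1 / (((sInf {n | x n ≠ y n} : ℕ) : ℝ) + 1)

def HasSMZ (S : Set (ℕ → ℤ)) : Prop :=
  ∀ ε : ℕ → ℝ, (∀ n, 0 < ε n) →
    ∃ U : ℕ → Set (ℕ → ℤ), S ⊆ ⋃ n, U n ∧
      ∀ n, ∀ x ∈ U n, ∀ y ∈ U n, specDist x y < ε n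

def HurewiczBoundedMul (G : Type*) [Group G] [TopologicalSpace G] : Prop :=
  ∀ U : ℕ → Set G, (∀ n, U n ∈ nhds (1 : G)) →
    ∃ F : ℕ → Finset G, ∀ g : G, ∀ᶠ n in atTop, g ∈ (F n : Set G) * U n

def LeftTotallyBounded {G : Type*} [Group G] [TopologicalSpace G] (B : Set G) : Prop :=
  ∀ U ∈ nhds (1 : G), ∃ F : Finset G, B ⊆ (F : Set G) * U

def TotallyBoundedIn {G : Type*} [Group G] [TopologicalSpace G] (B : Set G) : Prop :=
  ∀ U ∈ nhds (1 : G), ∃ F : Finset G, B ⊆ ((F : Set G) * U) ∩ (U * (F : Set G))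

/-- Every neighbourhood of zero in a subgroup of the Baer-Specker group contains all elements
vanishing on some initial segment. -/
theorem exists_initial_segment_of_mem_nhds_zero {G : AddSubgroup (ℕ → ℤ)} {U : Set G}
    (hU : U ∈ 𝓝 (0 : G)) : ∃ N : ℕ, ∀ g : G, (∀ i < N, (g : ℕ → ℤ) i = 0) → g ∈ U := by
  obtain ⟨V, hV, hVU⟩ := mem_nhds_subtype _ _ _ |>.1 hU
  rw [nhds_pi, Filter.mem_pi] at hV
  obtain ⟨I, hI, t, ht, htV⟩ := hV
  obtain ⟨N, hN⟩ := hI.bddAbove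
  refine ⟨N + 1, fun g hg => hVU (htV fun i hi => ?_)⟩
  rw [hg i (Nat.lt_succ_of_le (hN hi))]
  exact mem_of_mem_nhds (ht i)

/-- The elements vanishing on an initial segment form a neighbourhood of zero. -/
theorem setOf_vanishing_mem_nhds_zero (G : AddSubgroup (ℕ → ℤ)) (N : ℕ) :
    {g : G | ∀ i < N, (g : ℕ → ℤ) i = 0} ∈ 𝓝 (0 : G) := by
  have key : ∀ i : ℕ, {g : G | (g : ℕ → ℤ) i = 0} ∈ 𝓝 (0 : G) := fun i => by
    have hc : Continuous fun g : G => (g : ℕ → ℤ) i :=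
      (continuous_apply i).comp continuous_subtype_val
    exact ((isOpen_discrete ({0} : Set ℤ)).preimage hc).mem_nhds rfl
  have h := (Filter.biInter_mem (Set.finite_Iio N)).2 fun i _ => key i
  refine Filter.mem_of_superset h fun g hg i hi => ?_
  exact Set.mem_iInter₂.1 hg i hi

/-- Finitely many elements represent, up to agreement below `N`, all elements that are bounded
by `B` below `N`. -/
theorem exists_finset_representatives (G : AddSubgroup (ℕ → ℤ)) (N B : ℕ) :
    ∃ F : Finset G, ∀ g : G, (∀ i < N, |(g : ℕ → ℤ) i| ≤ (B : ℤ)) →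
      ∃ a ∈ F, ∀ i < N, (a : ℕ → ℤ) i = (g : ℕ → ℤ) i := by
  classical
  let r : G → Fin N → ℤ := fun g i => (g : ℕ → ℤ) i
  have hfin : (Set.Icc (fun _ => -(B : ℤ)) (fun _ => (B : ℤ)) : Set (Fin N → ℤ)).Finite :=
    Set.finite_Icc _ _
  refine ⟨hfin.toFinset.image (Function.invFun r), fun g hg =>
    ⟨Function.invFun r (r g), Finset.mem_image_of_mem _ ?_, fun i hi => ?_⟩⟩
  · rw [Set.Finite.mem_toFinset]
    exact ⟨fun i => (abs_le.1 (hg i i.2)).1, fun i => (abs_le.1 (hg i i.2)).2⟩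
  · exact congrFun (Function.invFun_eq (f := r) ⟨g, rfl⟩) ⟨i, hi⟩

theorem exists_bound_of_mengerBounded {G : AddSubgroup (ℕ → ℤ)} (hG : MengerBounded G)
    (h : ℕ → ℕ) : ∃ f : ℕ → ℕ, ∀ g ∈ G, ∃ n : ℕ, ∀ i < h n, |g i| ≤ (f n : ℤ) := by
  obtain ⟨F, hF⟩ := hG _ fun n => setOf_vanishing_mem_nhds_zero G (h n)
  refine ⟨fun n => (F n).sup fun a => (Finset.range (h n)).sup fun i =>
    ((a : ℕ → ℤ) i).natAbs, fun g hg => ?_⟩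
  obtain ⟨n, a, ha, u, hu, hau⟩ := hF ⟨g, hg⟩
  refine ⟨n, fun i hi => ?_⟩
  have hgi : g i = (a : ℕ → ℤ) i := by
    have h1 := congrFun (congrArg Subtype.val hau) i
    have h2 : (u : ℕ → ℤ) i = 0 := hu i hi
    simpa [h2] using h1.symm
  rw [hgi, Int.abs_eq_natAbs, Nat.cast_le]
  exact (Finset.le_sup (f := fun i => ((a : ℕ → ℤ) i).natAbs) (Finset.mem_range.2 hi)).trans
    (Finset.le_sup (f := fun a : G => (Finset.range (h n)).sup fun i =>
      ((a : ℕ → ℤ) i).natAbs) ha)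

theorem mengerBounded_of_exists_bound {G : AddSubgroup (ℕ → ℤ)}
    (hG : ∀ h : ℕ → ℕ, StrictMono h → ∃ f : ℕ → ℕ,
      ∀ g ∈ G, ∃ n : ℕ, ∀ i < h n, |g i| ≤ (f n : ℤ)) : MengerBounded G := by
  intro U hU
  choose N hN using fun n => exists_initial_segment_of_mem_nhds_zero (hU n)
  let h : ℕ → ℕ := fun n => ∑ k ∈ Finset.range (n + 1), (N k + 1)
  have hh : StrictMono h := strictMono_nat_of_lt_succ fun n => by
    simp only [h, Finset.sum_range_succ _ (n + 1)]
    omega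
  have hNh : ∀ n, N n ≤ h n := fun n => by
    simp only [h, Finset.sum_range_succ _ n]
    omega
  obtain ⟨f, hf⟩ := hG h hh
  choose F hF using fun n => exists_finset_representatives G (h n) (f n)
  refine ⟨F, fun g => ?_⟩
  obtain ⟨n, hn⟩ := hf g g.2
  obtain ⟨a, ha, hag⟩ := hF n g hn
  refine ⟨n, a, ha, -a + g, hN n _ fun i hi => ?_, add_neg_cancel_left a g⟩
  simp [hag i (hi.trans_le (hNh n))]

theorem frequently_bound_of_exists_bound {Y : Set (ℕ → ℤ)}
    (hY : ∀ h : ℕ → ℕ, StrictMono h → ∃ f : ℕ → ℕ,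
      ∀ g ∈ Y, ∃ n : ℕ, ∀ i < h n, |g i| ≤ (f n : ℤ))
    {h : ℕ → ℕ} (hh : StrictMono h) :
    ∃ f : ℕ → ℕ, ∀ g ∈ Y, ∃ᶠ n in atTop, ∀ i < h n, |g i| ≤ (f n : ℤ) := by
  choose f hf using fun m : ℕ =>
    hY (fun n => h (n + m)) fun a b hab => hh (Nat.add_lt_add_right hab m)
  refine ⟨fun n => (Finset.range (n + 1)).sup fun m => f m (n - m), fun g hg => ?_⟩
  refine frequently_atTop.2 fun m => ?_
  obtain ⟨n, hn⟩ := hf m g hg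
  refine ⟨n + m, Nat.le_add_left m n, fun i hi => (hn i hi).trans ?_⟩
  have := Finset.le_sup (f := fun k => f k (n + m - k))
    (Finset.mem_range.2 (show m < n + m + 1 by omega))
  simp only [Nat.add_sub_cancel] at this
  exact_mod_cast this

theorem exists_bound_of_frequently_bound {Y : Set (ℕ → ℤ)}
    (hY : ∃ f : ℕ → ℕ, ∀ g ∈ Y, ∃ᶠ n in atTop, ∀ i < n, |g i| ≤ (f n : ℤ))
    {h : ℕ → ℕ} (hh : StrictMono h) :
    ∃ f : ℕ → ℕ, ∀ g ∈ Y, ∃ n : ℕ, ∀ i < h n, |g i| ≤ (f n : ℤ) := by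
  obtain ⟨f, hf⟩ := hY
  refine ⟨fun k => (Finset.range (h (k + 1))).sup f, fun g hg => ?_⟩
  obtain ⟨n, hn, hgn⟩ := frequently_atTop.1 (hf g hg) (h 0)
  obtain ⟨k, hk, hk'⟩ : ∃ k, h k ≤ n ∧ n < h (k + 1) := by
    by_contra! hcon
    have hle : ∀ k, h k ≤ n := fun k => by
      induction k with
      | zero => exact hn
      | succ k ih => exact hcon k ih
    have h1 := hle (n + 1)
    have h2 := hh.le_apply (x := n + 1)
    omega
  refine ⟨k, fun i hi => (hgn i (hi.trans_le hk)).trans ?_⟩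
  exact_mod_cast Finset.le_sup (f := f) (Finset.mem_range.2 hk')

theorem stmt_0 (G : AddSubgroup (ℕ → ℤ)) :
    List.TFAE
      [MengerBounded ↥G,
       ∀ h : ℕ → ℕ, StrictMono h → ∃ f : ℕ → ℕ,
         ∀ g ∈ G, ∃ n : ℕ, ∀ i < h n, |g i| ≤ (f n : ℤ),
       ∀ h : ℕ → ℕ, StrictMono h → ∃ f : ℕ → ℕ,
         ∀ g ∈ G, ∃ᶠ n in atTop, ∀ i < h n, |g i| ≤ (f n : ℤ),
       ∃ f : ℕ → ℕ, ∀ g ∈ G, ∃ᶠ n in atTop, ∀ i < n, |g i| ≤ (f n : ℤ)] := by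
  tfae_have 1 → 2 := fun hG h _ => exists_bound_of_mengerBounded hG h
  tfae_have 2 → 1 := mengerBounded_of_exists_bound
  tfae_have 2 → 3 := fun hG _ hh =>
    frequently_bound_of_exists_bound (Y := (G : Set (ℕ → ℤ))) hG hh
  tfae_have 3 → 4 := fun hG => hG id strictMono_id
  tfae_have 4 → 2 := fun hG _ hh =>
    exists_bound_of_frequently_bound (Y := (G : Set (ℕ → ℤ))) hG hh
  tfae_finish
end

section
/- Let G be a subgroup of the Baer–Specker group ℤ^ℕ. The following are equivalent: (1) G is Hurewicz-bounded; (2) for each strictly increasing h : ℕ → ℕ there is f : ℕ → ℕ such that for every g ∈ G, for all but finitely many n, |g(i)| ≤ f(n) for all i < h(n); (3) G is ≤*-bounded, i.e., there is f : ℕ → ℕ such that for every g ∈ G, |g(n)| ≤ f(n) for all but finitely many n. -/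
open Filter Set Topology Pointwise

theorem HurewiczBounded.exists_eventual_bound {G : AddSubgroup (ℕ → ℤ)}
    (hG : HurewiczBounded ↥G) :
    ∃ f : ℕ → ℕ, ∀ g ∈ G, ∀ᶠ n in atTop, |g n| ≤ (f n : ℤ) := by
  obtain ⟨F, hF⟩ := hG (fun n => {g : G | (g : ℕ → ℤ) n = 0}) (fun n => by
    have hc : Continuous fun g : G => (g : ℕ → ℤ) n :=
      (continuous_apply n).comp continuous_subtype_val
    exact ((isOpen_discrete ({0} : Set ℤ)).preimage hc).mem_nhds (by simp))
  refine ⟨fun n => ∑ x ∈ F n, ((x : ℕ → ℤ) n).natAbs, fun g hg => ?_⟩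
  filter_upwards [hF ⟨g, hg⟩] with n hn
  obtain ⟨x, hx, u, hu, hxu⟩ := Set.mem_add.1 hn
  have hu : (u : ℕ → ℤ) n = 0 := hu
  have hgx : g n = (x : ℕ → ℤ) n := by
    have h := congrArg (fun y : G => (y : ℕ → ℤ) n) hxu
    simpa [hu] using h.symm
  rw [hgx, Int.abs_eq_natAbs, Int.ofNat_le]
  exact Finset.single_le_sum (f := fun x : G => ((x : ℕ → ℤ) n).natAbs)
    (fun _ _ => Nat.zero_le _) hx

theorem exists_eventual_bound_below {G : Set (ℕ → ℤ)} {f : ℕ → ℕ}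
    (hf : ∀ g ∈ G, ∀ᶠ n in atTop, |g n| ≤ (f n : ℤ)) (h : ℕ → ℕ) :
    ∃ f' : ℕ → ℕ, ∀ g ∈ G, ∀ᶠ n in atTop, ∀ i < h n, |g i| ≤ (f' n : ℤ) := by
  refine ⟨fun n => n + ∑ i ∈ Finset.range (h n), f i, fun g hg => ?_⟩
  obtain ⟨N, hN⟩ := eventually_atTop.1 (hf g hg)
  filter_upwards [eventually_ge_atTop (∑ i ∈ Finset.range N, (g i).natAbs)] with n hn i hi
  rcases lt_or_ge i N with hiN | hiN
  · have hle := Finset.single_le_sum (f := fun i => (g i).natAbs)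
      (fun _ _ => Nat.zero_le _) (Finset.mem_range.2 hiN)
    rw [Int.abs_eq_natAbs, Int.ofNat_le]
    exact (hle.trans hn).trans (Nat.le_add_right _ _)
  · have hle := Finset.single_le_sum (f := f)
      (fun _ _ => Nat.zero_le _) (Finset.mem_range.2 hi)
    exact (hN i hiN).trans (Int.ofNat_le.2 (hle.trans (Nat.le_add_left _ _)))

theorem exists_forall_lt_eq_zero_subset {G : AddSubgroup (ℕ → ℤ)} {U : Set G}
    (hU : U ∈ nhds (0 : G)) :
    ∃ m : ℕ, ∀ g : G, (∀ i < m, (g : ℕ → ℤ) i = 0) → g ∈ U := by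
  rw [nhds_subtype_eq_comap, mem_comap] at hU
  obtain ⟨V, hV, hVU⟩ := hU
  rw [nhds_pi, Filter.mem_pi] at hV
  obtain ⟨I, hI, t, ht, htV⟩ := hV
  obtain ⟨m, hm⟩ := hI.bddAbove
  refine ⟨m + 1, fun g hg => hVU (htV fun i hi => ?_)⟩
  rw [hg i (Nat.lt_succ_of_le (hm hi))]
  exact mem_of_mem_nhds (ht i)

theorem exists_finset_forall_bounded_eq_below (G : AddSubgroup (ℕ → ℤ)) (m b : ℕ) :
    ∃ F : Finset G, ∀ g : G, (∀ i < m, |(g : ℕ → ℤ) i| ≤ (b : ℤ)) →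
      ∃ x ∈ F, ∀ i < m, (x : ℕ → ℤ) i = (g : ℕ → ℤ) i := by
  let r : G → Fin m → ℤ := fun g i => (g : ℕ → ℤ) i
  let S : Set G := {g | ∀ i < m, |(g : ℕ → ℤ) i| ≤ (b : ℤ)}
  have hfin : (r '' S).Finite := by
    refine (Set.finite_Icc (fun _ => -(b : ℤ)) (fun _ => (b : ℤ))).subset ?_
    rintro _ ⟨g, hg, rfl⟩
    exact ⟨fun i => (abs_le.1 (hg i i.2)).1, fun i => (abs_le.1 (hg i i.2)).2⟩
  obtain ⟨T, -, hbij⟩ := Set.exists_subset_bijOn S r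
  have hT : T.Finite := Set.Finite.of_finite_image (hbij.image_eq ▸ hfin) hbij.injOn
  refine ⟨hT.toFinset, fun g hg => ?_⟩
  obtain ⟨x, hx, hxg⟩ := hbij.surjOn (mem_image_of_mem r (show g ∈ S from hg))
  exact ⟨x, hT.mem_toFinset.2 hx, fun i hi => congrFun hxg ⟨i, hi⟩⟩

theorem HurewiczBounded.of_exists_eventual_bound_below {G : AddSubgroup (ℕ → ℤ)}
    (hG : ∀ h : ℕ → ℕ, StrictMono h → ∃ f : ℕ → ℕ,
      ∀ g ∈ G, ∀ᶠ n in atTop, ∀ i < h n, |g i| ≤ (f n : ℤ)) :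
    HurewiczBounded ↥G := by
  intro U hU
  choose m hm using fun n => exists_forall_lt_eq_zero_subset (hU n)
  let h : ℕ → ℕ := fun n => ∑ k ∈ Finset.range (n + 1), (m k + 1)
  have hmono : StrictMono h := strictMono_nat_of_lt_succ fun n => by
    simp only [h]
    rw [Finset.sum_range_succ _ (n + 1)]
    omega
  have hmh : ∀ n, m n ≤ h n := fun n => by
    simp only [h]
    rw [Finset.sum_range_succ]
    omega
  obtain ⟨f, hf⟩ := hG h hmono
  choose F hF using fun n => exists_finset_forall_bounded_eq_below G (h n) (f n)
  refine ⟨F, fun g => ?_⟩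
  filter_upwards [hf g g.2] with n hn
  obtain ⟨x, hx, hxg⟩ := hF n g hn
  refine Set.mem_add.2 ⟨x, hx, g - x, hm n _ fun i hi => ?_, add_sub_cancel x g⟩
  simp [hxg i (hi.trans_le (hmh n))]

theorem stmt_2 (G : AddSubgroup (ℕ → ℤ)) :
    List.TFAE
      [HurewiczBounded ↥G,
       ∀ h : ℕ → ℕ, StrictMono h → ∃ f : ℕ → ℕ,
         ∀ g ∈ G, ∀ᶠ n in atTop, ∀ i < h n, |g i| ≤ (f n : ℤ),
       ∃ f : ℕ → ℕ, ∀ g ∈ G, ∀ᶠ n in atTop, |g n| ≤ (f n : ℤ)] := by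
  tfae_have 1 → 3 := HurewiczBounded.exists_eventual_bound
  tfae_have 3 → 2 := fun ⟨_, hf⟩ h _ => exists_eventual_bound_below (G := G) hf h
  tfae_have 2 → 1 := HurewiczBounded.of_exists_eventual_bound_below
  tfae_finish
end

section
/- Let G be a subgroup of the Baer–Specker group ℤ^ℕ. The following are equivalent: (1) G is Rothberger-bounded; (2) for each strictly increasing h : ℕ → ℕ there is a function φ assigning to each n ∈ ℕ a finite sequence φ(n) ∈ ℤ^{h(n)} such that for every g ∈ G there exists n with g(i) = φ(n)(i) for all i < h(n); (3) G has strong measure zero with respect to the metric d on ℤ^ℕ. Moreover, in (2) the quantifier 'there exists n' may be replaced by 'there exist infinitely many n'. -/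
open Filter Set Topology Pointwise

theorem exists_strictMono_ge (h : ℕ → ℕ) : ∃ k : ℕ → ℕ, StrictMono k ∧ ∀ n, h n ≤ k n := by
  refine ⟨fun n => n + ∑ i ∈ Finset.range (n + 1), h i, strictMono_nat_of_lt_succ fun n => ?_,
    fun n => ?_⟩
  · simp only [Finset.sum_range_succ _ (n + 1)]
    omega
  · simp only [Finset.sum_range_succ]
    omega

theorem specDist_lt_of_forall_lt_eq {x y : ℕ → ℤ} {m : ℕ} {ε : ℝ} (hm : 1 / ((m : ℝ) + 1) < ε)
    (hxy : ∀ i < m, x i = y i) : specDist x y < ε := by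
  unfold specDist
  split_ifs with h
  · exact lt_trans (by positivity) hm
  · have hne : {n | x n ≠ y n}.Nonempty := Function.ne_iff.mp h
    have hle : m ≤ sInf {n | x n ≠ y n} := by
      by_contra! hlt
      exact Nat.sInf_mem hne (hxy _ hlt)
    refine lt_of_le_of_lt ?_ hm
    gcongr

theorem eq_of_specDist_lt {x y : ℕ → ℤ} {m : ℕ} (hd : specDist x y < 1 / ((m : ℝ) + 1)) {i : ℕ}
    (hi : i < m) : x i = y i := by
  by_contra hne
  have hxy : x ≠ y := fun h => hne (congrFun h i)
  rw [specDist, if_neg hxy] at hd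
  have hle : sInf {n | x n ≠ y n} ≤ m := (Nat.sInf_le hne).trans hi.le
  refine absurd hd (not_lt.mpr ?_)
  gcongr

theorem setOf_forall_lt_eq_zero_mem_nhds (G : AddSubgroup (ℕ → ℤ)) (m : ℕ) :
    {g : G | ∀ i < m, (g : ℕ → ℤ) i = 0} ∈ 𝓝 (0 : G) := by
  have hopen : IsOpen {g : G | ∀ i < m, (g : ℕ → ℤ) i = 0} := by
    have : {g : G | ∀ i < m, (g : ℕ → ℤ) i = 0} =
        ⋂ i ∈ Finset.range m, (fun g : G => (g : ℕ → ℤ) i) ⁻¹' {0} := by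
      ext g
      simp
    rw [this]
    exact isOpen_biInter_finset fun i _ => (isOpen_discrete _).preimage
      ((continuous_apply i).comp continuous_subtype_val)
  exact hopen.mem_nhds fun i _ => rfl

theorem exists_setOf_forall_lt_eq_zero_subset {G : AddSubgroup (ℕ → ℤ)} {U : Set G}
    (hU : U ∈ 𝓝 (0 : G)) : ∃ m : ℕ, ∀ g : G, (∀ i < m, (g : ℕ → ℤ) i = 0) → g ∈ U := by
  obtain ⟨V, hV, hVU⟩ := mem_nhds_subtype _ _ _ |>.mp hU
  obtain ⟨W, hWV, hWopen, hW0⟩ := mem_nhds_iff.mp hV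
  obtain ⟨I, u, hu, hIW⟩ := isOpen_pi_iff.mp hWopen _ hW0
  refine ⟨I.sup id + 1, fun g hg => hVU (hWV (hIW fun i hi => ?_))⟩
  rw [hg i (Nat.lt_succ_of_le (Finset.le_sup (f := id) hi))]
  exact (hu i hi).2

theorem RothbergerBounded.rothbergerBddSet {G : AddSubgroup (ℕ → ℤ)} (hG : RothbergerBounded G) :
    RothbergerBddSet (G : Set (ℕ → ℤ)) := by
  intro h _
  obtain ⟨a, ha⟩ := hG _ fun n => setOf_forall_lt_eq_zero_mem_nhds G (h n)
  refine ⟨fun n i => (a n : ℕ → ℤ) i, fun g hg => ?_⟩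
  obtain ⟨n, b, hb, u, hu, hbu⟩ := ha ⟨g, hg⟩
  obtain rfl : b = a n := hb
  refine ⟨n, fun i => ?_⟩
  have hgi : (a n : ℕ → ℤ) i + (u : ℕ → ℤ) i = g i := congrFun (congrArg Subtype.val hbu) i
  rw [← hgi, hu i i.2, add_zero]

theorem RothbergerBddSet.rothbergerBounded {G : AddSubgroup (ℕ → ℤ)}
    (hG : RothbergerBddSet (G : Set (ℕ → ℤ))) : RothbergerBounded G := by
  intro U hU
  choose m hm using fun n => exists_setOf_forall_lt_eq_zero_subset (hU n)
  obtain ⟨h, hmono, hle⟩ := exists_strictMono_ge m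
  obtain ⟨φ, hφ⟩ := hG h hmono
  have key : ∀ n, ∃ a : G, ∀ g : G, (∀ i : Fin (h n), (g : ℕ → ℤ) i = φ n i) →
      ∀ i : Fin (h n), (g : ℕ → ℤ) i = (a : ℕ → ℤ) i := by
    intro n
    by_cases hex : ∃ a : G, ∀ i : Fin (h n), (a : ℕ → ℤ) i = φ n i
    · obtain ⟨a, ha⟩ := hex
      exact ⟨a, fun g hg i => (hg i).trans (ha i).symm⟩
    · exact ⟨0, fun g hg => absurd ⟨g, hg⟩ hex⟩
  choose a ha using key
  refine ⟨a, fun g => ?_⟩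
  obtain ⟨n, hn⟩ := hφ g g.2
  refine ⟨n, a n, rfl, -a n + g, hm n _ fun i hi => ?_, by simp⟩
  have hga := ha n g hn ⟨i, hi.trans_le (hle n)⟩
  simp at hga
  simp [hga]

theorem RothbergerBddSet.hasSMZ {S : Set (ℕ → ℤ)} (hS : RothbergerBddSet S) : HasSMZ S := by
  intro ε hε
  choose m hm using fun n => exists_nat_one_div_lt (hε n)
  obtain ⟨h, hmono, hle⟩ := exists_strictMono_ge m
  obtain ⟨φ, hφ⟩ := hS h hmono
  refine ⟨fun n => {y | ∀ i : Fin (h n), y i = φ n i}, fun y hy => mem_iUnion.mpr (hφ y hy),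
    fun n x hx y hy => specDist_lt_of_forall_lt_eq (hm n) fun i hi => ?_⟩
  have hi' := hi.trans_le (hle n)
  exact (hx ⟨i, hi'⟩).trans (hy ⟨i, hi'⟩).symm

theorem HasSMZ.rothbergerBddSet {S : Set (ℕ → ℤ)} (hS : HasSMZ S) : RothbergerBddSet S := by
  intro h _
  obtain ⟨U, hSU, hU⟩ := hS (fun n => 1 / ((h n : ℝ) + 1)) fun n => by positivity
  have key : ∀ n, ∃ x : ℕ → ℤ, ∀ y ∈ U n, ∀ i < h n, y i = x i := by
    intro n
    rcases (U n).eq_empty_or_nonempty with hn | ⟨x, hx⟩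
    · exact ⟨0, by simp [hn]⟩
    · exact ⟨x, fun y hy i hi => eq_of_specDist_lt (hU n y hy x hx) hi⟩
  choose x hx using key
  refine ⟨fun n i => x n i, fun y hy => ?_⟩
  obtain ⟨n, hn⟩ := mem_iUnion.mp (hSU hy)
  exact ⟨n, fun i => hx n y hn i i.2⟩

theorem RothbergerBddSet.exists_frequently_eq {S : Set (ℕ → ℤ)} (hS : RothbergerBddSet S)
    {h : ℕ → ℕ} (hmono : StrictMono h) : ∃ φ : (n : ℕ) → Fin (h n) → ℤ,
      ∀ y ∈ S, ∃ᶠ n in atTop, ∀ i : Fin (h n), y i.val = φ n i := by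
  have hpair : ∀ k, StrictMono fun m => h (Nat.pair k m) :=
    fun k _ _ hlt => hmono (Nat.pair_lt_pair_right k hlt)
  choose ψ hψ using fun k => hS _ (hpair k)
  refine ⟨fun n i => ψ n.unpair.1 n.unpair.2 ⟨i, by simp⟩, fun y hy =>
    frequently_atTop.mpr fun N => ?_⟩
  obtain ⟨m, hm⟩ := hψ N y hy
  refine ⟨Nat.pair N m, Nat.left_le_pair N m, fun i => ?_⟩
  have aux : ∀ p : ℕ × ℕ, p = (N, m) → ∀ hi : i.val < h (Nat.pair p.1 p.2),
      y i = ψ p.1 p.2 ⟨i, hi⟩ := by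
    rintro _ rfl hi
    exact hm ⟨i, hi⟩
  exact aux _ (Nat.unpair_pair N m) _

theorem stmt_3 (G : AddSubgroup (ℕ → ℤ)) :
    List.TFAE
      [RothbergerBounded ↥G,
       ∀ h : ℕ → ℕ, StrictMono h → ∃ φ : (n : ℕ) → Fin (h n) → ℤ,
         ∀ g ∈ G, ∃ n : ℕ, ∀ i : Fin (h n), g i.val = φ n i,
       HasSMZ (G : Set (ℕ → ℤ)),
       ∀ h : ℕ → ℕ, StrictMono h → ∃ φ : (n : ℕ) → Fin (h n) → ℤ,
         ∀ g ∈ G, ∃ᶠ n in atTop, ∀ i : Fin (h n), g i.val = φ n i] := by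
  tfae_have 1 → 2 := RothbergerBounded.rothbergerBddSet
  tfae_have 2 → 1 := RothbergerBddSet.rothbergerBounded
  tfae_have 2 → 3 := RothbergerBddSet.hasSMZ
  tfae_have 3 → 2 := HasSMZ.rothbergerBddSet
  tfae_have 2 → 4 := fun hG _ => RothbergerBddSet.exists_frequently_eq hG
  tfae_have 4 → 2 := fun hG h hmono =>
    (hG h hmono).imp fun _ hφ g hg => (hφ g hg).exists
  tfae_finish
end

section
/- The minimal cardinality of a subgroup of the Baer–Specker group ℤ^ℕ that is not Menger-bounded equals 𝔡, and the minimal cardinality of a subgroup of ℤ^ℕ that is not Scheepers-bounded also equals 𝔡. -/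
open Filter Set Topology Pointwise

def IsDominatingFamily (D : Set (ℕ → ℕ)) : Prop :=
  ∀ g : ℕ → ℕ, ∃ f ∈ D, ∀ᶠ n in atTop, g n ≤ f n

lemma frakd_le_mk {D : Set (ℕ → ℕ)} (hD : IsDominatingFamily D) : frakd ≤ Cardinal.mk D :=
  csInf_le' ⟨D, hD, rfl⟩

lemma exists_isDominatingFamily_mk_eq_frakd :
    ∃ D : Set (ℕ → ℕ), IsDominatingFamily D ∧ Cardinal.mk D = frakd :=
  csInf_mem (s := {c : Cardinal | ∃ D : Set (ℕ → ℕ), IsDominatingFamily D ∧ Cardinal.mk D = c})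
    ⟨_, univ, fun g => ⟨g, mem_univ g, Eventually.of_forall fun _ => le_rfl⟩, rfl⟩

lemma IsDominatingFamily.infinite {D : Set (ℕ → ℕ)} (hD : IsDominatingFamily D) : D.Infinite := by
  intro hfin
  obtain ⟨f, hf, hle⟩ := hD fun n => (∑ f ∈ hfin.toFinset, f n) + 1
  obtain ⟨n, hn⟩ := hle.exists
  have := Finset.single_le_sum (f := fun f : ℕ → ℕ => f n) (fun _ _ => Nat.zero_le _)
    (hfin.mem_toFinset.2 hf)
  omega

lemma ScheepersBounded.mengerBounded {G : Type*} [AddGroup G] [TopologicalSpace G]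
    (h : ScheepersBounded G) : MengerBounded G := by
  intro U hU
  obtain ⟨F, hF⟩ := h U hU
  refine ⟨F, fun g => ?_⟩
  obtain ⟨n, hn⟩ := hF {g}
  exact ⟨n, hn (by simp)⟩

lemma scheepersBounded_of_finite {G : Type*} [AddGroup G] [TopologicalSpace G] [Finite G] :
    ScheepersBounded G := by
  intro U hU
  cases nonempty_fintype G
  refine ⟨fun _ => Finset.univ, fun E => ⟨0, fun g _ => ?_⟩⟩
  exact ⟨g, by simp, 0, mem_of_mem_nhds (hU 0), add_zero g⟩

lemma exists_seq_forall_mem_add {G : Type*} [AddGroup G] [TopologicalSpace G]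
    [IsTopologicalAddGroup G] [SecondCountableTopology G] {U : Set G} (hU : U ∈ nhds (0 : G)) :
    ∃ d : ℕ → G, ∀ g, ∃ k, ∃ u ∈ U, d k + u = g := by
  obtain ⟨s, hs, hcov⟩ := TopologicalSpace.countable_cover_nhds
    (f := fun x : G => (fun y => -x + y) ⁻¹' U)
    (fun x => (continuous_const_add (-x)).continuousAt.preimage_mem_nhds (by simpa using hU))
  have hne : s.Nonempty := by
    obtain ⟨x, hx, -⟩ := mem_iUnion₂.1 (hcov ▸ mem_univ (0 : G))
    exact ⟨x, hx⟩
  obtain ⟨d, rfl⟩ := hs.exists_eq_range hne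
  refine ⟨d, fun g => ?_⟩
  obtain ⟨_, ⟨k, rfl⟩, hk⟩ := mem_iUnion₂.1 (hcov ▸ mem_univ g)
  exact ⟨k, -d k + g, hk, add_neg_cancel_left _ _⟩

lemma frakd_le_mk_of_not_scheepersBounded {G : Type} [AddGroup G] [TopologicalSpace G]
    [IsTopologicalAddGroup G] [SecondCountableTopology G] (h : ¬ ScheepersBounded G) :
    frakd ≤ Cardinal.mk G := by
  classical
  have : Infinite G := by
    by_contra hfin
    rw [not_infinite_iff_finite] at hfin
    exact h scheepersBounded_of_finite
  simp only [ScheepersBounded, not_forall, not_exists] at h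
  obtain ⟨U, hU, h⟩ := h
  choose d hd using fun n => exists_seq_forall_mem_add (hU n)
  choose k hk using hd
  let φ : Finset G → ℕ → ℕ := fun E n => E.sup (k n)
  have hdom : IsDominatingFamily (range φ) := by
    intro g
    obtain ⟨E, hE⟩ := h fun n => (Finset.range (g n)).image (d n)
    refine ⟨φ E, mem_range_self E, Eventually.of_forall fun n => ?_⟩
    by_contra! hlt
    refine hE n fun x hx => ?_
    obtain ⟨u, hu, hxu⟩ := hk n x
    exact ⟨d n (k n x), by
      simpa using ⟨k n x, (Finset.le_sup (f := k n) hx).trans_lt hlt, rfl⟩, u, hu, hxu⟩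
  calc frakd ≤ Cardinal.mk (range φ) := frakd_le_mk hdom
    _ ≤ Cardinal.mk (Finset G) := Cardinal.mk_range_le
    _ = Cardinal.mk G := Cardinal.mk_finset_of_infinite G

instance AddSubgroup.secondCountableTopology {A : Type*} [AddGroup A] [TopologicalSpace A]
    [SecondCountableTopology A] (G : AddSubgroup A) : SecondCountableTopology G :=
  TopologicalSpace.Subtype.secondCountableTopology (G : Set A)

lemma IsDominatingFamily.not_mengerBounded {D : Set (ℕ → ℕ)} (hD : IsDominatingFamily D)
    {G : AddSubgroup (ℕ → ℤ)} (hone : (1 : ℕ → ℤ) ∈ G)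
    (hG : ∀ f ∈ D, (fun n => (f n : ℤ)) ∈ G) : ¬ MengerBounded G := by
  intro h
  obtain ⟨F, hF⟩ := h (fun n => {x : G | x.1 n = 0}) fun n =>
    (((continuous_apply n).comp continuous_subtype_val).isOpen_preimage {0}
      (isOpen_discrete _)).mem_nhds (mem_singleton _)
  obtain ⟨f, hfD, hf⟩ := hD fun n => ((F n).sup fun x => (x.1 n).natAbs) + 1
  obtain ⟨N, hN⟩ := eventually_atTop.1 hf
  let b : ℕ → ℕ := fun n => ((F n).sup fun x => (x.1 n).natAbs) + 1
  let K : ℕ := ∑ n ∈ Finset.range N, b n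
  have hle (n : ℕ) : b n ≤ f n + K := by
    rcases lt_or_ge n N with hn | hn
    · exact (Finset.single_le_sum (f := b) (fun _ _ => Nat.zero_le _)
        (Finset.mem_range.2 hn)).trans (Nat.le_add_left _ _)
    · exact (hN n hn).trans (Nat.le_add_right _ _)
  obtain ⟨n, x, hx, u, hu, hxu⟩ := hF ⟨_, G.add_mem (hG f hfD) (G.nsmul_mem hone K)⟩
  have hval : x.1 n + u.1 n = f n + K := by
    simpa using congrFun (congrArg Subtype.val hxu) n
  have hu' : u.1 n = 0 := hu
  have hsup := Finset.le_sup (f := fun x : G => (x.1 n).natAbs) hx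
  have := hle n
  simp only [b] at this hsup
  omega

lemma exists_addSubgroup_mk_le {D : Set (ℕ → ℕ)} (hD : D.Infinite) :
    ∃ G : AddSubgroup (ℕ → ℤ), (1 : ℕ → ℤ) ∈ G ∧ (∀ f ∈ D, (fun n => (f n : ℤ)) ∈ G) ∧
      Cardinal.mk G ≤ Cardinal.mk D := by
  have : Infinite D := hD.to_subtype
  let v : Option D → ℕ → ℤ := fun o => o.elim 1 fun f n => (f.1 n : ℤ)
  let L := Finsupp.linearCombination ℤ v
  have hv (o : Option D) : v o ∈ (LinearMap.range L).toAddSubgroup :=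
    ⟨Finsupp.single o 1, by simp [L]⟩
  refine ⟨(LinearMap.range L).toAddSubgroup, hv none, fun f hf => hv (some ⟨f, hf⟩), ?_⟩
  calc Cardinal.mk (range L) ≤ Cardinal.mk (Option D →₀ ℤ) := Cardinal.mk_range_le
    _ = Cardinal.mk D := by simp

lemma exists_not_mengerBounded_mk_eq_frakd :
    ∃ G : AddSubgroup (ℕ → ℤ), ¬ MengerBounded G ∧ Cardinal.mk G = frakd := by
  obtain ⟨D, hD, hcard⟩ := exists_isDominatingFamily_mk_eq_frakd
  obtain ⟨G, hone, hG, hle⟩ := exists_addSubgroup_mk_le hD.infinite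
  have hM := hD.not_mengerBounded hone hG
  exact ⟨G, hM, (hle.trans_eq hcard).antisymm
    (frakd_le_mk_of_not_scheepersBounded fun hS => hM hS.mengerBounded)⟩

theorem stmt_8 :
    sInf {c : Cardinal | ∃ G : AddSubgroup (ℕ → ℤ),
        ¬ MengerBounded ↥G ∧ Cardinal.mk ↥G = c} = frakd ∧
    sInf {c : Cardinal | ∃ G : AddSubgroup (ℕ → ℤ),
        ¬ ScheepersBounded ↥G ∧ Cardinal.mk ↥G = c} = frakd := by
  obtain ⟨G, hM, hG⟩ := exists_not_mengerBounded_mk_eq_frakd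
  have hS : ¬ ScheepersBounded G := fun hS => hM hS.mengerBounded
  constructor
  · refine IsLeast.csInf_eq ⟨⟨G, hM, hG⟩, ?_⟩
    rintro _ ⟨H, hH, rfl⟩
    exact frakd_le_mk_of_not_scheepersBounded fun hS => hH hS.mengerBounded
  · refine IsLeast.csInf_eq ⟨⟨G, hS, hG⟩, ?_⟩
    rintro _ ⟨H, hH, rfl⟩
    exact frakd_le_mk_of_not_scheepersBounded hH
end

section
/- The minimal cardinality of a subgroup of the Baer–Specker group ℤ^ℕ that is not Hurewicz-bounded equals 𝔟. -/
open Filter Set Topology Pointwise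

theorem frakb_le_mk_of_unbounded {ι : Type} (f : ι → ℕ → ℕ)
    (hf : ∀ g : ℕ → ℕ, ∃ i, ¬ ∀ᶠ n in atTop, f i n ≤ g n) : frakb ≤ Cardinal.mk ι := by
  refine le_trans (csInf_le' ?_) (Cardinal.mk_range_le (f := f))
  refine ⟨range f, fun g => ?_, rfl⟩
  obtain ⟨i, hi⟩ := hf g
  exact ⟨f i, mem_range_self i, hi⟩

theorem exists_unbounded_mk_eq_frakb :
    ∃ B : Set (ℕ → ℕ),
      (∀ g : ℕ → ℕ, ∃ f ∈ B, ¬ ∀ᶠ n in atTop, f n ≤ g n) ∧ Cardinal.mk ↥B = frakb := by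
  refine csInf_mem (s := {c : Cardinal | ∃ B : Set (ℕ → ℕ),
    (∀ g : ℕ → ℕ, ∃ f ∈ B, ¬ ∀ᶠ n in atTop, f n ≤ g n) ∧ Cardinal.mk ↥B = c})
    ⟨_, univ, fun g => ⟨fun n => g n + 1, mem_univ _, fun h => ?_⟩, rfl⟩
  obtain ⟨n, hn⟩ := h.exists
  exact absurd hn (Nat.not_succ_le_self _)

theorem infinite_of_unbounded {B : Set (ℕ → ℕ)}
    (hB : ∀ g : ℕ → ℕ, ∃ f ∈ B, ¬ ∀ᶠ n in atTop, f n ≤ g n) : B.Infinite := by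
  intro hfin
  obtain ⟨f, hf, hfg⟩ := hB fun n => hfin.toFinset.sup fun f => f n
  exact hfg (Eventually.of_forall fun n =>
    Finset.le_sup (f := fun f : ℕ → ℕ => f n) (hfin.mem_toFinset.2 hf))

/-- A separable topological group of cardinality less than `𝔟` is Hurewicz-bounded. -/
theorem HurewiczBounded.of_mk_lt_frakb {G : Type} [AddGroup G] [TopologicalSpace G]
    [IsTopologicalAddGroup G] [TopologicalSpace.SeparableSpace G] (hG : Cardinal.mk G < frakb) :
    HurewiczBounded G := by
  intro U hU
  have key : ∀ (g : G) (n : ℕ), ∃ k, g ∈ ({TopologicalSpace.denseSeq G k} : Set G) + U n := by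
    intro g n
    have hV : {x : G | -x + g ∈ U n} ∈ 𝓝 g := by
      have hc : Tendsto (fun x : G => -x + g) (𝓝 g) (𝓝 0) := by
        have : Continuous fun x : G => -x + g := by fun_prop
        simpa using this.tendsto g
      exact hc (hU n)
    obtain ⟨_, ⟨k, rfl⟩, hx⟩ := (TopologicalSpace.denseRange_denseSeq G).inter_nhds_nonempty hV
    exact ⟨k, _, rfl, _, hx, by simp⟩
  choose f hf using key
  obtain ⟨h, hh⟩ : ∃ h : ℕ → ℕ, ∀ g, ∀ᶠ n in atTop, f g n ≤ h n := by
    by_contra! hcon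
    exact hG.not_ge (frakb_le_mk_of_unbounded f fun g =>
      (hcon g).imp fun _ hi => by simpa only [not_eventually, not_le] using hi)
  classical
  refine ⟨fun n => (Finset.range (h n + 1)).image (TopologicalSpace.denseSeq G), fun g => ?_⟩
  filter_upwards [hh g] with n hn
  refine add_subset_add_right ?_ (hf g n)
  rw [singleton_subset_iff, Finset.mem_coe]
  exact Finset.mem_image_of_mem _ (Finset.mem_range.2 (Nat.lt_succ_of_le hn))

theorem HurewiczBounded.hurewiczBddSet {G : AddSubgroup (ℕ → ℤ)} (hG : HurewiczBounded ↥G) :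
    HurewiczBddSet (G : Set (ℕ → ℤ)) := by
  have hU : ∀ n : ℕ, {g : ↥G | (g : ℕ → ℤ) n = 0} ∈ 𝓝 (0 : ↥G) := by
    intro n
    have hc : Continuous fun g : ↥G => (g : ℕ → ℤ) n :=
      (continuous_apply n).comp continuous_subtype_val
    exact ((isOpen_discrete ({0} : Set ℤ)).preimage hc).mem_nhds rfl
  obtain ⟨F, hF⟩ := hG _ hU
  refine ⟨fun n => (F n).sup fun a => ((a : ℕ → ℤ) n).natAbs, fun y hy => ?_⟩
  filter_upwards [hF ⟨y, hy⟩] with n hn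
  obtain ⟨a, ha, u, hu, hau⟩ := hn
  have hy' : y n = (a : ℕ → ℤ) n := by
    have h1 : (a : ℕ → ℤ) n + (u : ℕ → ℤ) n = y n := congrFun (congrArg Subtype.val hau) n
    rw [← h1, show (u : ℕ → ℤ) n = 0 from hu, add_zero]
  rw [hy', Int.abs_eq_natAbs]
  exact_mod_cast Finset.le_sup (f := fun a : ↥G => ((a : ℕ → ℤ) n).natAbs) ha

theorem AddSubgroup.mk_closure_le_of_infinite {A : Type} [AddCommGroup A] {s : Set A}
    (hs : s.Infinite) : Cardinal.mk ↥(AddSubgroup.closure s) ≤ Cardinal.mk ↥s := by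
  have := hs.to_subtype
  have hrange : (AddSubgroup.closure s : Set A) =
      range (Finsupp.linearCombination ℤ ((↑) : ↥s → A)) := by
    rw [← Submodule.span_int_eq_addSubgroupClosure, Submodule.coe_toAddSubgroup,
      Finsupp.span_eq_range_linearCombination]
    rfl
  calc Cardinal.mk ↥(AddSubgroup.closure s : Set A)
      ≤ Cardinal.mk (↥s →₀ ℤ) := by rw [hrange]; exact Cardinal.mk_range_le
    _ = Cardinal.mk ↥s := by
      rw [Cardinal.mk_finsupp_of_infinite, Cardinal.mk_int]
      exact max_eq_left (Cardinal.aleph0_le_mk _)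

theorem exists_not_hurewiczBounded_mk_le_frakb :
    ∃ G : AddSubgroup (ℕ → ℤ), ¬ HurewiczBounded ↥G ∧ Cardinal.mk ↥G ≤ frakb := by
  obtain ⟨B, hB, hcard⟩ := exists_unbounded_mk_eq_frakb
  let c : (ℕ → ℕ) → ℕ → ℤ := fun f n => f n
  have hc : Function.Injective c := fun f g h => funext fun n => Int.ofNat_inj.1 (congrFun h n)
  refine ⟨AddSubgroup.closure (c '' B), fun hG => ?_, ?_⟩
  · obtain ⟨h, hh⟩ := hG.hurewiczBddSet
    obtain ⟨f, hf, hfh⟩ := hB h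
    refine hfh ((hh _ (AddSubgroup.subset_closure (mem_image_of_mem c hf))).mono fun n hn => ?_)
    exact Int.ofNat_le.1 ((le_abs_self _).trans hn)
  · rw [← hcard]
    exact (AddSubgroup.mk_closure_le_of_infinite
      ((infinite_of_unbounded hB).image hc.injOn)).trans Cardinal.mk_image_le

theorem stmt_9 :
    sInf {c : Cardinal | ∃ G : AddSubgroup (ℕ → ℤ),
        ¬ HurewiczBounded ↥G ∧ Cardinal.mk ↥G = c} = frakb := by
  obtain ⟨G, hG, hcard⟩ := exists_not_hurewiczBounded_mk_le_frakb
  refine le_antisymm (le_trans (csInf_le' ?_) hcard) (le_csInf ⟨_, G, hG, rfl⟩ ?_)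
  · exact ⟨G, hG, rfl⟩
  rintro _ ⟨H, hH, rfl⟩
  have : SecondCountableTopology ↥H :=
    inferInstanceAs (SecondCountableTopology (H : Set (ℕ → ℤ)))
  exact not_lt.1 fun hlt => hH (HurewiczBounded.of_mk_lt_frakb hlt)
end

section
/- The minimal cardinality of a subgroup of the Baer–Specker group ℤ^ℕ that is not Rothberger-bounded equals cov(ℳ). -/
open Filter Set Topology Pointwise

/-- Fewer than `covMeager` functions into a countable type are guessed by a single one. -/
theorem exists_guess_of_mk_lt {X : Type} {A : ℕ → Type} [∀ n, Countable (A n)]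
    (hX : Cardinal.mk X < covMeager) (r : X → (n : ℕ) → A n) :
    ∃ x : ℕ → Option X, ∀ y : X, ∃ n, ∃ z ∈ x n, r y n = r z n := by
  classical
  have he : ∀ n, ∃ e : A n → ℕ, Function.Injective e := fun n => exists_injective_nat (A n)
  choose e he using he
  have hguess : ∃ f : ℕ → ℕ, ∀ y ∈ range (fun (x : X) n => e n (r x n)), ∃ n, f n = y n := by
    by_contra h
    have hle : covMeager ≤ Cardinal.mk (range fun (x : X) n => e n (r x n)) :=
      csInf_le' ⟨_, h, rfl⟩
    exact absurd (hle.trans Cardinal.mk_range_le) (not_le.2 hX)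
  obtain ⟨f, hf⟩ := hguess
  refine ⟨fun n => if h : ∃ z, f n = e n (r z n) then some h.choose else none, fun y => ?_⟩
  obtain ⟨n, hn⟩ := hf _ ⟨y, rfl⟩
  have h : ∃ z, f n = e n (r z n) := ⟨y, hn⟩
  refine ⟨n, h.choose, by simp [dif_pos h], he n ?_⟩
  exact hn.symm.trans h.choose_spec

/-- Neighborhoods of zero in a subgroup of `ℕ → ℤ` contain all elements vanishing on some
initial segment. -/
theorem exists_forall_lt_eq_zero_imp_mem (G : AddSubgroup (ℕ → ℤ)) {U : Set G}
    (hU : U ∈ nhds (0 : G)) :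
    ∃ k : ℕ, ∀ g : G, (∀ i < k, g.1 i = 0) → g ∈ U := by
  rw [nhds_subtype_eq_comap, mem_comap] at hU
  obtain ⟨V, hV, hVU⟩ := hU
  rw [nhds_pi, Filter.mem_pi] at hV
  obtain ⟨I, hI, t, ht, htV⟩ := hV
  obtain ⟨k, hk⟩ := hI.bddAbove
  refine ⟨k + 1, fun g hg => hVU (htV fun i hi => ?_)⟩
  rw [hg i (Nat.lt_succ_of_le (hk hi))]
  exact mem_of_mem_nhds (ht i)

theorem rothbergerBounded_of_mk_lt (G : AddSubgroup (ℕ → ℤ))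
    (hG : Cardinal.mk G < covMeager) : RothbergerBounded G := by
  intro U hU
  choose k hk using fun n => exists_forall_lt_eq_zero_imp_mem G (hU n)
  obtain ⟨x, hx⟩ := exists_guess_of_mk_lt (A := fun n => Fin (k n) → ℤ) hG
    (fun g n i => g.1 i)
  refine ⟨fun n => (x n).getD 0, fun g => ?_⟩
  obtain ⟨n, z, hz, hgz⟩ := hx g
  refine ⟨n, Set.mem_add.2 ⟨z, ?_, -z + g, hk n _ fun i hi => ?_, by abel⟩⟩
  · simp [Option.mem_def.1 hz]
  · have := congrFun hgz ⟨i, hi⟩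
    simp only at this
    simp [this]

theorem not_rothbergerBounded_of_mem (Y : Set (ℕ → ℕ))
    (hY : ¬ ∃ f : ℕ → ℕ, ∀ y ∈ Y, ∃ n, f n = y n) (G : AddSubgroup (ℕ → ℤ))
    (hG : ∀ y ∈ Y, (fun n => (y n : ℤ)) ∈ G) : ¬ RothbergerBounded G := by
  intro h
  obtain ⟨a, ha⟩ := h (fun n => {g : G | g.1 n = 0}) fun n => by
    have hc : Continuous fun g : G => g.1 n := (continuous_apply n).comp continuous_subtype_val
    exact ((isOpen_discrete ({0} : Set ℤ)).preimage hc).mem_nhds (by simp)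
  refine hY ⟨fun n => ((a n).1 n).toNat, fun y hy => ?_⟩
  obtain ⟨n, hn⟩ := ha ⟨_, hG y hy⟩
  obtain ⟨b, hb, u, hu, hbu⟩ := Set.mem_add.1 hn
  have h1 := congrFun (congrArg Subtype.val hbu) n
  have hu' : u.1 n = 0 := hu
  rw [Set.mem_singleton_iff] at hb
  subst hb
  simp [hu'] at h1
  exact ⟨n, by simp [h1]⟩

theorem infinite_of_not_exists_guess (Y : Set (ℕ → ℕ))
    (hY : ¬ ∃ f : ℕ → ℕ, ∀ y ∈ Y, ∃ n, f n = y n) : Y.Infinite := by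
  intro hfin
  rcases Y.eq_empty_or_nonempty with rfl | hne
  · exact hY ⟨0, by simp⟩
  · obtain ⟨s, rfl⟩ := hfin.countable.exists_eq_range hne
    exact hY ⟨fun n => s n n, by rintro _ ⟨n, rfl⟩; exact ⟨n, rfl⟩⟩

theorem exists_not_rothbergerBounded :
    ∃ G : AddSubgroup (ℕ → ℤ), ¬ RothbergerBounded G ∧ Cardinal.mk G ≤ covMeager := by
  have hne : {c : Cardinal | ∃ Y : Set (ℕ → ℕ),
      (¬ ∃ f : ℕ → ℕ, ∀ y ∈ Y, ∃ n, f n = y n) ∧ Cardinal.mk ↥Y = c}.Nonempty := by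
    refine ⟨_, univ, ?_, rfl⟩
    rintro ⟨f, hf⟩
    obtain ⟨n, hn⟩ := hf (fun n => f n + 1) (mem_univ _)
    simp at hn
  obtain ⟨Y, hY, hcard⟩ := csInf_mem hne
  have hinf : Infinite Y := (infinite_of_not_exists_guess Y hY).to_subtype
  have hne : Nonempty Y := inferInstance
  let v : Y → ℕ → ℤ := fun y n => (y.1 n : ℤ)
  refine ⟨(Finsupp.linearCombination ℤ v).toAddMonoidHom.range,
    not_rothbergerBounded_of_mem Y hY _ fun y hy => ⟨Finsupp.single ⟨y, hy⟩ 1, ?_⟩, ?_⟩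
  · simp [v]
  · refine (Cardinal.mk_range_le (f := (Finsupp.linearCombination ℤ v))).trans ?_
    rw [Cardinal.mk_finsupp_of_infinite]
    exact (max_le le_rfl (by simp)).trans hcard.le

theorem stmt_10 :
    sInf {c : Cardinal | ∃ G : AddSubgroup (ℕ → ℤ),
        ¬ RothbergerBounded ↥G ∧ Cardinal.mk ↥G = c} = covMeager := by
  obtain ⟨G, hG, hcard⟩ := exists_not_rothbergerBounded
  refine le_antisymm (le_trans (csInf_le' ⟨G, hG, rfl⟩) hcard) (le_csInf ⟨_, G, hG, rfl⟩ ?_)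
  rintro _ ⟨H, hH, rfl⟩
  exact not_lt.1 fun hlt => hH (rothbergerBounded_of_mk_lt H hlt)
end

section
/- Let X = {0,1}^ℕ be the set of all 0–1 valued sequences, regarded as a subset of the Baer–Specker group ℤ^ℕ, and let G be the subgroup of ℤ^ℕ generated by X. Then G is σ-compact (in particular, Hurewicz-bounded), but G is not Rothberger-bounded. -/
open Filter Set Topology Pointwise

theorem hurewiczBounded_of_sigmaCompactSpace (G : Type*) [AddGroup G] [TopologicalSpace G]
    [IsTopologicalAddGroup G] [SigmaCompactSpace G] : HurewiczBounded G := by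
  intro U hU
  have hcover : ∀ n, ∃ F : Finset G, compactCovering G n ⊆ (F : Set G) + U n := by
    classical
    intro n
    obtain ⟨t, ht⟩ := compact_covered_by_add_left_translates (isCompact_compactCovering G n)
      ⟨0, mem_interior_iff_mem_nhds.2 (hU n)⟩
    refine ⟨t.image (fun g => -g), fun x hx => ?_⟩
    obtain ⟨g, hg, hgx⟩ := mem_iUnion₂.1 (ht hx)
    exact Set.mem_add.2 ⟨-g, by simpa using hg, g + x, hgx, by simp⟩
  choose F hF using hcover
  refine ⟨F, fun g => ?_⟩
  obtain ⟨m, hm⟩ := exists_mem_compactCovering g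
  filter_upwards [eventually_ge_atTop m] with n hn
  exact hF n (compactCovering_subset G hn hm)

theorem mem_closure_zero_one_of_nonneg_of_le (k : ℕ) :
    ∀ x : ℕ → ℤ, (∀ n, 0 ≤ x n) → (∀ n, x n ≤ k) →
      x ∈ AddSubgroup.closure {x : ℕ → ℤ | ∀ n, x n = 0 ∨ x n = 1} := by
  induction k with
  | zero =>
    intro x h0 hk
    have hx : x = 0 := funext fun n => le_antisymm (by simpa using hk n) (h0 n)
    exact hx ▸ zero_mem _
  | succ k ih =>
    intro x h0 hk
    have hmin : (fun n => min (x n) 1) ∈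
        AddSubgroup.closure {x : ℕ → ℤ | ∀ n, x n = 0 ∨ x n = 1} :=
      AddSubgroup.subset_closure fun n => by
        have := h0 n
        show min (x n) 1 = 0 ∨ min (x n) 1 = 1
        omega
    have hrest := ih (fun n => x n - min (x n) 1)
      (fun n => by have := h0 n; show 0 ≤ x n - min (x n) 1; omega)
      (fun n => by
        have := h0 n
        have := hk n
        push_cast at this
        show x n - min (x n) 1 ≤ k
        omega)
    have hx : x = (fun n => min (x n) 1) + fun n => x n - min (x n) 1 :=
      funext fun n => by simp
    rw [hx]
    exact add_mem hmin hrest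

theorem mem_closure_zero_one_iff (x : ℕ → ℤ) :
    x ∈ AddSubgroup.closure {x : ℕ → ℤ | ∀ n, x n = 0 ∨ x n = 1} ↔
      ∃ k : ℕ, ∀ n, -(k : ℤ) ≤ x n ∧ x n ≤ k := by
  constructor
  · intro hx
    induction hx using AddSubgroup.closure_induction with
    | mem x hx => exact ⟨1, fun n => by have := hx n; push_cast; omega⟩
    | zero => exact ⟨0, fun n => by simp⟩
    | add x y _ _ hx hy =>
      obtain ⟨k, hk⟩ := hx
      obtain ⟨l, hl⟩ := hy
      refine ⟨k + l, fun n => ?_⟩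
      have := hk n
      have := hl n
      rw [Pi.add_apply]
      push_cast
      omega
    | neg x _ hx =>
      obtain ⟨k, hk⟩ := hx
      refine ⟨k, fun n => ?_⟩
      have := hk n
      rw [Pi.neg_apply]
      omega
  · rintro ⟨k, hk⟩
    have hshift := mem_closure_zero_one_of_nonneg_of_le (2 * k) (fun n => x n + k)
      (fun n => by have := hk n; show 0 ≤ x n + (k : ℤ); omega)
      (fun n => by have := hk n; show x n + (k : ℤ) ≤ (2 * k : ℕ); push_cast; omega)
    have hconst := mem_closure_zero_one_of_nonneg_of_le k (fun _ => (k : ℤ))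
      (fun _ => Int.natCast_nonneg k) (fun _ => le_rfl)
    have hx : x = (fun n => x n + (k : ℤ)) - fun _ => (k : ℤ) := funext fun n => by simp
    rw [hx]
    exact sub_mem hshift hconst

theorem isSigmaCompact_closure_zero_one :
    IsSigmaCompact (AddSubgroup.closure {x : ℕ → ℤ | ∀ n, x n = 0 ∨ x n = 1} :
      Set (ℕ → ℤ)) := by
  refine ⟨fun k : ℕ => Set.pi univ fun _ => Icc (-(k : ℤ)) k,
    fun k => isCompact_univ_pi fun _ => isCompact_Icc, ?_⟩
  ext x
  simp only [mem_iUnion, mem_univ_pi, mem_Icc, SetLike.mem_coe, mem_closure_zero_one_iff]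

theorem not_rothbergerBounded_of_zero_one_mem (G : AddSubgroup (ℕ → ℤ))
    (hG : ∀ x : ℕ → ℤ, (∀ n, x n = 0 ∨ x n = 1) → x ∈ G) : ¬ RothbergerBounded ↥G := by
  intro h
  have hopen : ∀ n, IsOpen {g : G | (g : ℕ → ℤ) n = 0} := fun n => by
    have hc : Continuous fun g : G => (g : ℕ → ℤ) n :=
      (continuous_apply (A := fun _ : ℕ => ℤ) n).comp continuous_subtype_val
    exact (isOpen_discrete ({0} : Set ℤ)).preimage hc
  obtain ⟨a, ha⟩ := h (fun n => {g | (g : ℕ → ℤ) n = 0}) fun n => (hopen n).mem_nhds rfl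
  let x : ℕ → ℤ := fun n => if (a n : ℕ → ℤ) n = 0 then 1 else 0
  have hx : x ∈ G := hG x fun n => by
    by_cases hn : (a n : ℕ → ℤ) n = 0 <;> simp [x, hn]
  obtain ⟨n, hn⟩ := ha ⟨x, hx⟩
  obtain ⟨b, rfl, u, hu, hbu⟩ := Set.mem_add.1 hn
  have hval : (a n : ℕ → ℤ) n + (u : ℕ → ℤ) n = x n :=
    congrFun (congrArg Subtype.val hbu) n
  have hu' : (u : ℕ → ℤ) n = 0 := hu
  rw [hu', add_zero] at hval
  by_cases h0 : (a n : ℕ → ℤ) n = 0 <;> simp [x, h0] at hval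

theorem stmt_11 (G : AddSubgroup (ℕ → ℤ))
    (hG : G = AddSubgroup.closure {x : ℕ → ℤ | ∀ n, x n = 0 ∨ x n = 1}) :
    IsSigmaCompact (G : Set (ℕ → ℤ)) ∧ HurewiczBounded ↥G ∧ ¬ RothbergerBounded ↥G := by
  subst hG
  have hσ := isSigmaCompact_closure_zero_one
  have := isSigmaCompact_iff_sigmaCompactSpace.1 hσ
  exact ⟨hσ, hurewiczBounded_of_sigmaCompactSpace _,
    not_rothbergerBounded_of_zero_one_mem _ fun _ hx => AddSubgroup.subset_closure hx⟩
end

section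
/- Assume cov(ℳ) = 𝔠 (the cardinality of the continuum). Then there exists a subgroup G of the Baer–Specker group ℤ^ℕ such that G is Rothberger-bounded and Scheepers-bounded, but G is not Hurewicz-bounded. -/
open Filter Set Topology Pointwise

/-- Recursive choice along a well-order: if each partial construction extends by one step, then
there is a function all of whose values satisfy the step requirement. -/
lemma exists_forall_of_wellFounded {ι X : Type*} [LinearOrder ι] [WellFoundedLT ι] [Nonempty X]
    (P : ι → (ι → X) → X → Prop)
    (hlocal : ∀ i F F', (∀ j < i, F j = F' j) → ∀ x, P i F x → P i F' x)
    (hstep : ∀ i F, (∀ j < i, P j F (F j)) → ∃ x, P i F x) :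
    ∃ F : ι → X, ∀ i, P i F (F i) := by
  classical
  let x₀ : X := Classical.arbitrary X
  let step : (i : ι) → ((j : ι) → j < i → X) → X := fun i prev =>
    Classical.epsilon (P i fun j => if h : j < i then prev j h else x₀)
  let F : ι → X := (wellFounded_lt (α := ι)).fix step
  have hF : ∀ i, F i = Classical.epsilon (P i fun j => if j < i then F j else x₀) := by
    intro i
    have := (wellFounded_lt (α := ι)).fix_eq step i
    simpa only [step, dite_eq_ite] using this
  refine ⟨F, fun i => ?_⟩
  induction i using WellFoundedLT.induction with
  | ind i ih =>
    obtain ⟨x, hx⟩ := hstep i F ih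
    have hagree : ∀ j < i, F j = if j < i then F j else x₀ := fun j hj => by simp [hj]
    have hε := Classical.epsilon_spec ⟨x, hlocal i _ _ hagree x hx⟩
    rw [← hF i] at hε
    exact hlocal i _ _ (fun j hj => (hagree j hj).symm) _ hε

lemma exists_injective_mem (A : ℕ → Finset ℕ) :
    ∃ x : ℕ → ℕ, Function.Injective x ∧ ∀ k, k < (A k).card → x k ∈ A k := by
  obtain ⟨x, hx⟩ := exists_forall_of_wellFounded
    (fun k (F : ℕ → ℕ) y => (∀ j < k, F j ≠ y) ∧ (k < (A k).card → y ∈ A k)) (by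
      rintro k F F' hFF' y ⟨h₁, h₂⟩
      exact ⟨fun j hj => hFF' j hj ▸ h₁ j hj, h₂⟩) (by
      intro k F _
      by_cases hk : k < (A k).card
      · have hcard : ((Finset.range k).image F).card < (A k).card :=
          (Finset.card_image_le.trans_eq (Finset.card_range k)).trans_lt hk
        obtain ⟨y, hy, hyF⟩ := Finset.exists_mem_notMem_of_card_lt_card hcard
        refine ⟨y, fun j hj hjy => hyF ?_, fun _ => hy⟩
        exact Finset.mem_image.2 ⟨j, Finset.mem_range.2 hj, hjy⟩
      · obtain ⟨y, hyF⟩ := Infinite.exists_notMem_finset ((Finset.range k).image F)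
        refine ⟨y, fun j hj hjy => hyF ?_, fun h => absurd h hk⟩
        exact Finset.mem_image.2 ⟨j, Finset.mem_range.2 hj, hjy⟩)
  refine ⟨x, fun a b hab => ?_, fun k => (hx k).2⟩
  rcases lt_trichotomy a b with h | h | h
  · exact absurd hab ((hx b).1 a h)
  · exact h
  · exact absurd hab.symm ((hx a).1 b h)

lemma exists_guess {ι : Type} (hι : Cardinal.mk ι < covMeager) {α : Type*} [Countable α]
    [Nonempty α] (y : ι → ℕ → α) : ∃ f : ℕ → α, ∀ i, ∃ n, f n = y i n := by
  obtain ⟨c, hc⟩ := exists_injective_nat α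
  have hsmall : ∃ f : ℕ → ℕ, ∀ z ∈ range fun i n => c (y i n), ∃ n, f n = z n := by
    by_contra h
    have hle : covMeager ≤ Cardinal.mk (range fun i n => c (y i n)) := csInf_le' ⟨_, h, rfl⟩
    exact (hι.trans_le (hle.trans Cardinal.mk_range_le)).false
  obtain ⟨f, hf⟩ := hsmall
  refine ⟨fun n => Function.invFun c (f n), fun i => ?_⟩
  obtain ⟨n, hn⟩ := hf _ (mem_range_self i)
  exact ⟨n, by simp only [hn, Function.leftInverse_invFun hc (y i n)]⟩

lemma exists_frequently_le {ι : Type} (hι : Cardinal.mk (ι × ℕ) < covMeager)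
    (L : ι → ℕ → ℕ) : ∃ h : ℕ → ℕ, ∀ i m, ∃ n ≥ m, L i n ≤ h n := by
  obtain ⟨h, hh⟩ := exists_guess hι fun (p : ι × ℕ) n => L p.1 n + p.2
  refine ⟨h, fun i m => ?_⟩
  obtain ⟨n, hn⟩ := hh (i, (∑ j ∈ Finset.range m, h j) + 1)
  refine ⟨n, ?_, by simp only [hn]; omega⟩
  by_contra! hnm
  have := Finset.single_le_sum (fun j _ => Nat.zero_le (h j)) (Finset.mem_range.2 hnm)
  simp only at hn
  omega

lemma exists_interval_partition {ι : Type} (hι : Cardinal.mk (ι × ℕ) < covMeager)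
    (L : ι → ℕ → ℕ) (hmono : ∀ i, Monotone (L i)) :
    ∃ N : ℕ → ℕ, StrictMono N ∧ N 0 = 0 ∧ ∀ i m, ∃ k ≥ m, L i (N k) ≤ N (k + 1) := by
  obtain ⟨h, hh⟩ := exists_frequently_le hι fun i n => L i (L i n)
  let h' : ℕ → ℕ := fun n => n + 1 + ∑ j ∈ Finset.range (n + 1), h j
  have hh' : Monotone h' := fun a b hab => by
    have := Finset.sum_le_sum_of_subset (f := h)
      (Finset.range_mono (Nat.succ_le_succ hab))
    simp only [h', Nat.succ_eq_add_one] at this ⊢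
    omega
  have hle : ∀ n, h n ≤ h' n := fun n => by
    have := Finset.single_le_sum (fun j _ => Nat.zero_le (h j)) (Finset.self_mem_range_succ n)
    simp only [h']
    omega
  let N : ℕ → ℕ := fun k => h'^[k] 0
  have hN : ∀ k, N (k + 1) = h' (N k) := fun k => Function.iterate_succ_apply' h' k 0
  have hNmono : StrictMono N := strictMono_nat_of_lt_succ fun k => by
    rw [hN]; simp only [h']; omega
  refine ⟨N, hNmono, rfl, fun i m => ?_⟩
  obtain ⟨n, hn, hLn⟩ := hh i (N m)
  have hex : ∃ k, n < N (k + 1) :=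
    ⟨n, (Nat.lt_succ_self n).trans_le (hNmono.le_apply)⟩
  set k := Nat.find hex with hk
  have hlt : n < N (k + 1) := Nat.find_spec hex
  have hkn : N k ≤ n := by
    rcases Nat.eq_zero_or_pos k with h0 | h0
    · rw [h0]; exact Nat.zero_le _
    · have := Nat.find_min hex (Nat.sub_lt h0 Nat.one_pos)
      rw [not_lt, ← hk, Nat.sub_add_cancel h0] at this
      exact this
  have hmk : m ≤ k := by
    by_contra! hkm
    exact (hlt.trans_le (hNmono.monotone hkm)).not_ge hn
  by_cases hc : L i n ≤ N (k + 1)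
  · exact ⟨k, hmk, (hmono i hkn).trans hc⟩
  · refine ⟨k + 1, hmk.trans k.le_succ, ?_⟩
    calc L i (N (k + 1)) ≤ L i (L i n) := hmono i (not_le.1 hc).le
      _ ≤ h n := hLn
      _ ≤ h' n := hle n
      _ ≤ h' (N (k + 1)) := hh' hlt.le
      _ = N (k + 1 + 1) := (hN _).symm

/-- Fewer than `covMeager` dense sets (each given by a strategy `e i` for entering it) of a relation
on the natural numbers are all met along a single sequence. -/
lemma exists_generic_nat {ι : Type} (hι : Cardinal.mk (ι × ℕ) < covMeager)
    (R : ℕ → ℕ → Prop) (hrefl : ∀ p, R p p) (e : ι → ℕ → ℕ) (he : ∀ i p, R p (e i p)) :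
    ∃ p : ℕ → ℕ, (∀ k, R (p k) (p (k + 1))) ∧ ∀ i, ∃ k, p (k + 1) = e i (p k) := by
  classical
  let L : ι → ℕ → ℕ := fun i n => ∑ j ∈ Finset.range (n + 1), e i j
  have heL : ∀ i {p n}, p ≤ n → e i p ≤ L i n := fun i p n hpn =>
    Finset.single_le_sum (fun j _ => Nat.zero_le (e i j))
      (Finset.mem_range.2 (Nat.lt_succ_of_le hpn))
  obtain ⟨N, hN, hN0, hNL⟩ := exists_interval_partition hι L fun i a b hab =>
    Finset.sum_le_sum_of_subset (Finset.range_mono (Nat.succ_le_succ hab))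
  have hfreq : ∀ i k, ∃ A : Finset ℕ, (A : Set ℕ) ⊆ {x | L i (N x) ≤ N (x + 1)} ∧
      A.card = k + 1 := fun i k =>
    (Set.infinite_of_forall_exists_gt fun m => by
      obtain ⟨x, hx, hxL⟩ := hNL i (m + 1)
      exact ⟨x, hxL, hx⟩).exists_subset_card_eq _
  choose A hA hAcard using hfreq
  have hbound : ∀ i k, ∃ B, ∀ x ∈ A i k, N x ≤ B := fun i k =>
    ⟨∑ x ∈ A i k, N x, fun x hx => Finset.single_le_sum (fun j _ => Nat.zero_le (N j)) hx⟩
  choose B hB using hbound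
  have hι' : Cardinal.mk ι < covMeager :=
    (Cardinal.mk_le_of_injective (f := fun i : ι => (i, 0)) fun a b h =>
      congrArg Prod.fst h).trans_lt hι
  obtain ⟨f, hf⟩ := exists_guess hι' fun i k =>
    (A i k, (List.range (B i k + 1)).map (e i))
  obtain ⟨x, hxinj, hx⟩ := exists_injective_mem fun k => (f k).1
  let q : ℕ → ℕ → ℕ := fun k p => (f (Function.invFun x k)).2.getD p 0
  let p : ℕ → ℕ := fun k => Nat.rec 0
    (fun k p => if R p (q k p) ∧ q k p ≤ N (k + 1) then q k p else p) k
  have hp : ∀ k, p (k + 1) =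
      if R (p k) (q k (p k)) ∧ q k (p k) ≤ N (k + 1) then q k (p k) else p k := fun _ => rfl
  have hpN : ∀ k, p k ≤ N k := by
    intro k
    induction k with
    | zero => exact Nat.zero_le _
    | succ k ih =>
      rw [hp]
      split_ifs with h
      · exact h.2
      · exact ih.trans (hN.monotone k.le_succ)
  refine ⟨p, fun k => ?_, fun i => ?_⟩
  · rw [hp]
    split_ifs with h
    · exact h.1
    · exact hrefl _
  · obtain ⟨j, hj⟩ := hf i
    have hxA : x j ∈ A i j := by
      have := hx j
      rw [hj] at this
      exact this (by simp only [hAcard]; omega)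
    have hq : q (x j) (p (x j)) = e i (p (x j)) := by
      have hlt : p (x j) < B i j + 1 := Nat.lt_succ_of_le ((hpN _).trans (hB i j _ hxA))
      simp only [q, Function.leftInverse_invFun hxinj j, hj]
      simp [List.getD_eq_getElem?_getD, hlt]
    refine ⟨x j, ?_⟩
    rw [hp, hq, if_pos ⟨he i _, (heL i (hpN _)).trans (hA i j hxA)⟩]

lemma exists_generic {ι P : Type} [Countable P] [Infinite P]
    (hι : Cardinal.mk (ι × ℕ) < covMeager)
    (R : P → P → Prop) (hrefl : ∀ p, R p p) (e : ι → P → P) (he : ∀ i p, R p (e i p)) :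
    ∃ p : ℕ → P, (∀ k, R (p k) (p (k + 1))) ∧ ∀ i, ∃ k, p (k + 1) = e i (p k) := by
  obtain ⟨_⟩ := nonempty_denumerable P
  let c := Denumerable.eqv P
  obtain ⟨p, hp, hpe⟩ := exists_generic_nat hι (fun a b => R (c.symm a) (c.symm b))
    (fun _ => hrefl _) (fun i a => c (e i (c.symm a))) fun i a => by simpa using he i (c.symm a)
  refine ⟨fun k => c.symm (p k), hp, fun i => ?_⟩
  obtain ⟨k, hk⟩ := hpe i
  exact ⟨k, by simp [hk]⟩

/-- Fewer than `covMeager` dense open subsets of the Baer–Specker group have a common point. -/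
lemma exists_mem_of_dense_open {ι : Type} (hι : Cardinal.mk (ι × ℕ) < covMeager)
    (D : ι → Set (ℕ → ℤ))
    (hD : ∀ i (t : ℕ →₀ ℤ) m, ∃ t' : ℕ →₀ ℤ, ∃ m' ≥ m, (∀ k < m, t' k = t k) ∧
      ∀ g : ℕ → ℤ, (∀ k < m', g k = t' k) → g ∈ D i) :
    ∃ g, ∀ i, g ∈ D i := by
  choose e b hb het heD using hD
  let R : ℕ × (ℕ →₀ ℤ) → ℕ × (ℕ →₀ ℤ) → Prop := fun p q =>
    p.1 ≤ q.1 ∧ ∀ k < p.1, q.2 k = p.2 k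
  obtain ⟨p, hp, hpe⟩ := exists_generic hι R (fun p => ⟨le_rfl, fun _ _ => rfl⟩)
    (fun i q => (b i q.2 q.1, e i q.2 q.1)) fun i q => ⟨hb i q.2 q.1, het i q.2 q.1⟩
  have : Std.Refl R := ⟨fun p => ⟨le_rfl, fun _ _ => rfl⟩⟩
  have : IsTrans (ℕ × (ℕ →₀ ℤ)) R := ⟨fun p q r hpq hqr =>
    ⟨hpq.1.trans hqr.1, fun k hk => (hqr.2 k (hk.trans_le hpq.1)).trans (hpq.2 k hk)⟩⟩
  have hmono := Nat.rel_of_forall_rel_succ_of_le R hp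
  classical
  let g : ℕ → ℤ := fun j => if h : ∃ k, j < (p k).1 then (p h.choose).2 j else 0
  have hg : ∀ k, ∀ j < (p k).1, g j = (p k).2 j := by
    intro k j hj
    have h : ∃ k, j < (p k).1 := ⟨k, hj⟩
    simp only [g, dif_pos h]
    rcases le_total h.choose k with hle | hle
    · exact ((hmono hle).2 j h.choose_spec).symm
    · exact (hmono hle).2 j hj
  refine ⟨g, fun i => ?_⟩
  obtain ⟨k, hk⟩ := hpe i
  refine heD i (p k).2 (p k).1 g fun j hj => ?_
  have := hg (k + 1) j
  rw [hk] at this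
  exact this hj

/-- The list of the first `k` values of a sequence. -/
def initialValues (k : ℕ) (x : ℕ → ℤ) : List ℤ := (List.range k).map x

lemma initialValues_eq_iff {k : ℕ} {x y : ℕ → ℤ} :
    initialValues k x = initialValues k y ↔ ∀ i < k, x i = y i := by
  simp [initialValues]

/-- `φ` predicts every finite tuple from `H`: for some `n`, the entry `φ n` lists the restrictions
of the members of the tuple to their first `h n` coordinates. -/
def Predicts (φ : ℕ → List (List ℤ)) (h : ℕ → ℕ) (H : AddSubgroup (ℕ → ℤ)) : Prop :=
  ∀ L : List (ℕ → ℤ), (∀ x ∈ L, x ∈ H) → ∃ n, φ n = L.map (initialValues (h n))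

/-- The subgroup generated by the finitely supported sequences and the `g i` with `i ∈ A`. -/
def generatedBy {ι : Type*} (g : ι → ℕ → ℤ) (A : Set ι) : AddSubgroup (ℕ → ℤ) :=
  AddSubgroup.closure (range (fun t : ℕ →₀ ℤ => (t : ℕ → ℤ)) ∪ g '' A)

lemma Cardinal.mk_list_lt_continuum {α : Type} (hα : Cardinal.mk α < Cardinal.continuum) :
    Cardinal.mk (List α) < Cardinal.continuum :=
  (Cardinal.mk_list_le_max α).trans_lt (max_lt Cardinal.aleph0_lt_continuum hα)

lemma AddSubgroup.mk_closure_lt_continuum {S : Set (ℕ → ℤ)}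
    (hS : Cardinal.mk S < Cardinal.continuum) :
    Cardinal.mk (AddSubgroup.closure S) < Cardinal.continuum := by
  have hneg : Cardinal.mk ↥(-S) < Cardinal.continuum := by
    rw [← Set.image_neg_eq_neg]
    exact Cardinal.mk_image_le.trans_lt hS
  have hT : Cardinal.mk ↥(S ∪ -S) < Cardinal.continuum :=
    (Cardinal.mk_union_le _ _).trans_lt
      (Cardinal.add_lt_of_lt Cardinal.aleph0_le_continuum hS hneg)
  have hsub : (AddSubgroup.closure S : Set (ℕ → ℤ)) ⊆
      range fun l : List ↥(S ∪ -S) => (l.map Subtype.val).sum := by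
    intro x hx
    rw [SetLike.mem_coe, ← AddSubgroup.mem_toAddSubmonoid,
      AddSubgroup.closure_toAddSubmonoid] at hx
    obtain ⟨l, hl, rfl⟩ := AddSubmonoid.exists_list_of_mem_closure hx
    exact ⟨l.pmap Subtype.mk hl, by simp [List.map_pmap]⟩
  exact ((Cardinal.mk_le_mk_of_subset hsub).trans Cardinal.mk_range_le).trans_lt
    (Cardinal.mk_list_lt_continuum hT)

lemma mk_generatedBy_lt_continuum {ι : Type} (g : ι → ℕ → ℤ) {A : Set ι}
    (hA : Cardinal.mk A < Cardinal.continuum) :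
    Cardinal.mk (generatedBy g A) < Cardinal.continuum := by
  refine AddSubgroup.mk_closure_lt_continuum ((Cardinal.mk_union_le _ _).trans_lt
    (Cardinal.add_lt_of_lt Cardinal.aleph0_le_continuum ?_ (Cardinal.mk_image_le.trans_lt hA)))
  exact (Cardinal.mk_le_aleph0_iff.2 (Set.countable_range _).to_subtype).trans_lt
    Cardinal.aleph0_lt_continuum

lemma Predicts.mono {φ : ℕ → List (List ℤ)} {h : ℕ → ℕ} {H H' : AddSubgroup (ℕ → ℤ)}
    (hφ : Predicts φ h H') (hH : H ≤ H') : Predicts φ h H :=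
  fun L hL => hφ L fun x hx => hH (hL x hx)

lemma exists_predicts (hcov : covMeager = Cardinal.continuum) (h : ℕ → ℕ)
    {H : AddSubgroup (ℕ → ℤ)} (hH : Cardinal.mk H < Cardinal.continuum) :
    ∃ φ, Predicts φ h H := by
  obtain ⟨φ, hφ⟩ := exists_guess (hcov ▸ Cardinal.mk_list_lt_continuum hH)
    fun (L : List H) n => L.map fun x : H => initialValues (h n) x
  refine ⟨φ, fun L hL => ?_⟩
  obtain ⟨n, hn⟩ := hφ (L.pmap Subtype.mk hL)
  exact ⟨n, by rw [hn, List.map_pmap]; simp⟩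

lemma exists_unbounded_predicts_sup (hcov : covMeager = Cardinal.continuum) {κ : Type}
    (hκ : Cardinal.mk κ < Cardinal.continuum) (φ : κ → ℕ → List (List ℤ)) (h : κ → ℕ → ℕ)
    {H : AddSubgroup (ℕ → ℤ)} (hH : Cardinal.mk H < Cardinal.continuum)
    (hfin : ∀ t : ℕ →₀ ℤ, (t : ℕ → ℤ) ∈ H) (hφ : ∀ i, Predicts (φ i) (h i) H) (f : ℕ → ℤ) :
    ∃ g : ℕ → ℤ, (∀ i, Predicts (φ i) (h i) (H ⊔ AddSubgroup.zmultiples g)) ∧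
      ∀ m, ∃ n ≥ m, f n < g n := by
  have hc := Cardinal.aleph0_le_continuum
  have h0 : Cardinal.mk ℕ < Cardinal.continuum := by simp [Cardinal.aleph0_lt_continuum]
  have hι : Cardinal.mk ((ℕ ⊕ κ × List (H × ℤ)) × ℕ) < covMeager := by
    rw [hcov, Cardinal.mk_prod, Cardinal.mk_sum, Cardinal.mk_prod]
    simp only [Cardinal.lift_id]
    refine Cardinal.mul_lt_of_lt hc (Cardinal.add_lt_of_lt hc h0 (Cardinal.mul_lt_of_lt hc hκ
      (Cardinal.mk_list_lt_continuum ?_))) h0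
    rw [Cardinal.mk_prod]
    simp only [Cardinal.lift_id]
    exact Cardinal.mul_lt_of_lt hc hH (by simp [Cardinal.aleph0_lt_continuum])
  let D : ℕ ⊕ κ × List (H × ℤ) → Set (ℕ → ℤ) := Sum.elim
    (fun m => {g | ∃ n ≥ m, f n < g n})
    fun i => {g | ∃ n, φ i.1 n = i.2.map fun p => initialValues (h i.1 n) (p.1 + p.2 • g)}
  obtain ⟨g, hg⟩ := exists_mem_of_dense_open hι D (by
    rintro (m₀ | ⟨i, L⟩) t m
    · let n := max m m₀
      refine ⟨t + Finsupp.single n (f n + 1 - t n), n + 1, by omega, fun k hk => ?_,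
        fun g hg => ⟨n, le_max_right _ _, ?_⟩⟩
      · rw [Finsupp.add_apply, Finsupp.single_eq_of_ne (by omega), add_zero]
      · rw [hg n n.lt_succ_self, Finsupp.add_apply, Finsupp.single_eq_same]
        omega
    · obtain ⟨n, hn⟩ := hφ i (L.map fun p => p.1 + p.2 • (t : ℕ → ℤ)) (by
        simp only [List.mem_map]
        rintro _ ⟨p, -, rfl⟩
        exact H.add_mem p.1.2 (H.zsmul_mem (hfin t) _))
      refine ⟨t, max m (h i n), le_max_left _ _, fun _ _ => rfl, fun g hg => ⟨n, ?_⟩⟩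
      rw [hn, List.map_map]
      refine List.map_congr_left fun p _ => initialValues_eq_iff.2 fun k hk => ?_
      simp [hg k (hk.trans_le (le_max_right _ _))])
  refine ⟨g, fun i L hL => ?_, fun m => hg (Sum.inl m)⟩
  have hsplit : ∀ x, ∃ p : H × ℤ, x ∈ H ⊔ AddSubgroup.zmultiples g →
      (p.1 : ℕ → ℤ) + p.2 • g = x := by
    intro x
    by_cases hx : x ∈ H ⊔ AddSubgroup.zmultiples g
    · obtain ⟨y, hy, z, hz, rfl⟩ := AddSubgroup.mem_sup.1 hx
      obtain ⟨j, rfl⟩ := AddSubgroup.mem_zmultiples_iff.1 hz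
      exact ⟨(⟨y, hy⟩, j), fun _ => rfl⟩
    · exact ⟨0, fun h => absurd h hx⟩
  choose s hs using hsplit
  obtain ⟨n, hn⟩ := hg (Sum.inr (i, L.map s))
  refine ⟨n, hn.trans ?_⟩
  rw [List.map_map]
  exact List.map_congr_left fun x hx =>
    congrArg (initialValues (h i n)) (hs x (hL x hx))

lemma generatedBy_mono {ι : Type*} (g : ι → ℕ → ℤ) {A B : Set ι} (hAB : A ⊆ B) :
    generatedBy g A ≤ generatedBy g B :=
  AddSubgroup.closure_mono (union_subset_union_right _ (image_mono hAB))

lemma coe_mem_generatedBy {ι : Type*} (g : ι → ℕ → ℤ) (A : Set ι) (t : ℕ →₀ ℤ) :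
    (t : ℕ → ℤ) ∈ generatedBy g A :=
  AddSubgroup.subset_closure (Or.inl (mem_range_self t))

lemma generatedBy_congr {ι : Type*} {g g' : ι → ℕ → ℤ} {A : Set ι} (h : ∀ i ∈ A, g i = g' i) :
    generatedBy g A = generatedBy g' A := by
  rw [generatedBy, generatedBy, image_congr h]

lemma generatedBy_Iic {ι : Type*} [LinearOrder ι] (g : ι → ℕ → ℤ) (i : ι) :
    generatedBy g (Iic i) = generatedBy g (Iio i) ⊔ AddSubgroup.zmultiples (g i) := by
  rw [generatedBy, generatedBy, ← Iio_insert, image_insert_eq, union_insert, ← union_singleton,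
    AddSubgroup.closure_union, AddSubgroup.zmultiples_eq_closure]

lemma exists_mem_generatedBy_Iic {ι : Type*} [LinearOrder ι] {g : ι → ℕ → ℤ} {A : Set ι}
    (hA : A.Nonempty) {x : ℕ → ℤ} (hx : x ∈ generatedBy g A) :
    ∃ i ∈ A, x ∈ generatedBy g (Iic i) := by
  obtain ⟨i₀, hi₀⟩ := hA
  induction hx using AddSubgroup.closure_induction with
  | mem x hx =>
    rcases hx with ⟨t, rfl⟩ | ⟨i, hi, rfl⟩
    · exact ⟨i₀, hi₀, coe_mem_generatedBy g _ t⟩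
    · exact ⟨i, hi, AddSubgroup.subset_closure (Or.inr ⟨i, self_mem_Iic, rfl⟩)⟩
  | zero => exact ⟨i₀, hi₀, zero_mem _⟩
  | add x y _ _ hx hy =>
    obtain ⟨i, hi, hxi⟩ := hx
    obtain ⟨j, hj, hyj⟩ := hy
    rcases le_total i j with hij | hij
    · exact ⟨j, hj, add_mem (generatedBy_mono g (Iic_subset_Iic.2 hij) hxi) hyj⟩
    · exact ⟨i, hi, add_mem hxi (generatedBy_mono g (Iic_subset_Iic.2 hij) hyj)⟩
  | neg x _ hx =>
    obtain ⟨i, hi, hxi⟩ := hx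
    exact ⟨i, hi, neg_mem hxi⟩

lemma predicts_generatedBy {ι : Type*} [LinearOrder ι] {g : ι → ℕ → ℤ} {A : Set ι}
    {φ : ℕ → List (List ℤ)} {h : ℕ → ℕ} {j : ι} (hj : j ∈ A)
    (hφ : ∀ i ∈ A, j ≤ i → Predicts φ h (generatedBy g (Iic i))) :
    Predicts φ h (generatedBy g A) := by
  intro L hL
  have hbound : ∃ i ∈ A, j ≤ i ∧ ∀ x ∈ L, x ∈ generatedBy g (Iic i) := by
    induction L with
    | nil => exact ⟨j, hj, le_rfl, by simp⟩
    | cons x L ih =>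
      obtain ⟨i, hi, hji, hLi⟩ := ih fun y hy => hL y (List.mem_cons_of_mem x hy)
      obtain ⟨k, hk, hxk⟩ := exists_mem_generatedBy_Iic ⟨j, hj⟩ (hL x List.mem_cons_self)
      refine ⟨max i k, by rcases max_choice i k with h | h <;> rwa [h], hji.trans (le_max_left _ _),
        List.forall_mem_cons.2 ⟨?_, fun y hy => ?_⟩⟩
      · exact generatedBy_mono g (Iic_subset_Iic.2 (le_max_right _ _)) hxk
      · exact generatedBy_mono g (Iic_subset_Iic.2 (le_max_left _ _)) (hLi y hy)
  obtain ⟨i, hi, hji, hLi⟩ := hbound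
  exact hφ i hi hji L hLi

/-- Under `cov(ℳ) = 𝔠` there is a subgroup without eventual bound all of whose finite tuples are
predicted, for every choice of initial segments. -/
lemma exists_predicted_unbounded_addSubgroup (hcov : covMeager = Cardinal.continuum) :
    ∃ G : AddSubgroup (ℕ → ℤ), (∀ h : ℕ → ℕ, ∃ φ, Predicts φ h G) ∧
      ∀ f : ℕ → ℕ, ∃ g ∈ G, ∀ m, ∃ n ≥ m, (f n : ℤ) < g n := by
  let ι := Cardinal.continuum.{0}.ord.ToType
  have hι : Cardinal.mk ι = Cardinal.mk (ℕ → ℕ) := by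
    simp [ι]
  obtain ⟨h⟩ := Cardinal.eq.1 hι
  have hIio : ∀ i : ι, Cardinal.mk (Iio i) < Cardinal.continuum := fun i => by
    simpa [ι] using Cardinal.mk_Iio_lt i
  obtain ⟨F, hF⟩ := exists_forall_of_wellFounded
    (fun (i : ι) (F : ι → (ℕ → List (List ℤ)) × (ℕ → ℤ)) x =>
      (∀ j < i, Predicts (F j).1 (h j)
        (generatedBy (fun k => (F k).2) (Iio i) ⊔ AddSubgroup.zmultiples x.2)) ∧
      Predicts x.1 (h i)
        (generatedBy (fun k => (F k).2) (Iio i) ⊔ AddSubgroup.zmultiples x.2) ∧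
      ∀ m, ∃ n ≥ m, (h i n : ℤ) < x.2 n)
    (by
      rintro i F F' hFF' x ⟨h₁, h₂, h₃⟩
      have hgen : generatedBy (fun k => (F k).2) (Iio i) = generatedBy (fun k => (F' k).2) (Iio i) :=
        generatedBy_congr fun j hj => by rw [hFF' j hj]
      rw [← hgen]
      exact ⟨fun j hj => hFF' j hj ▸ h₁ j hj, h₂, h₃⟩)
    (by
      intro i F ih
      have hH := mk_generatedBy_lt_continuum (fun k => (F k).2) (hIio i)
      obtain ⟨φ, hφ⟩ := exists_predicts hcov (h i) hH
      have hpred : ∀ j < i, Predicts (F j).1 (h j) (generatedBy (fun k => (F k).2) (Iio i)) := by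
        refine fun j hj => predicts_generatedBy hj fun k hk hjk => ?_
        rw [generatedBy_Iic]
        rcases hjk.lt_or_eq with hlt | rfl
        · exact (ih k hk).1 j hlt
        · exact (ih j hk).2.1
      obtain ⟨g, hg, hgf⟩ := exists_unbounded_predicts_sup hcov
        (κ := Option (Iio i)) (by
          rw [Cardinal.mk_option]
          exact Cardinal.add_lt_of_lt Cardinal.aleph0_le_continuum
            (hIio i) (Cardinal.one_lt_aleph0.trans Cardinal.aleph0_lt_continuum))
        (fun j => j.elim φ fun j => (F j).1) (fun j => j.elim (h i) fun j => h j) hH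
        (coe_mem_generatedBy _ _) (by
          rintro (_ | j)
          · exact hφ
          · exact hpred j j.2) fun n => h i n
      exact ⟨(φ, g), fun j hj => hg (some ⟨j, hj⟩), hg none, hgf⟩)
  refine ⟨generatedBy (fun k => (F k).2) univ, fun f => ?_, fun f => ?_⟩
  · obtain ⟨j, rfl⟩ := h.surjective f
    refine ⟨(F j).1, predicts_generatedBy (mem_univ j) fun i _ hji => ?_⟩
    rw [generatedBy_Iic]
    rcases hji.lt_or_eq with hlt | rfl
    · exact (hF i).1 j hlt
    · exact (hF j).2.1
  · obtain ⟨j, rfl⟩ := h.surjective f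
    exact ⟨(F j).2, AddSubgroup.subset_closure (Or.inr ⟨j, mem_univ j, rfl⟩), (hF j).2.2⟩

lemma exists_initial_zero_subset {G : AddSubgroup (ℕ → ℤ)} {U : Set G} (hU : U ∈ nhds (0 : G)) :
    ∃ k, ∀ g : G, (∀ i < k, (g : ℕ → ℤ) i = 0) → g ∈ U := by
  obtain ⟨V, hV, hVU⟩ := (mem_nhds_subtype _ _ _).1 hU
  rw [AddSubgroup.coe_zero, nhds_pi, Filter.mem_pi] at hV
  obtain ⟨I, hI, t, ht, hIV⟩ := hV
  obtain ⟨b, hb⟩ := hI.bddAbove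
  refine ⟨b + 1, fun g hg => hVU (hIV fun i hi => ?_)⟩
  rw [hg i (Nat.lt_succ_of_le (hb hi))]
  exact mem_of_mem_nhds (ht i)

/-- For every sequence of neighborhoods there is one sequence of finite lists from `G` such that
every finite list from `G` is, for some `n`, entrywise in the `U n`-translates of the `n`-th one. -/
lemma exists_translates {G : AddSubgroup (ℕ → ℤ)} (hG : ∀ h : ℕ → ℕ, ∃ φ, Predicts φ h G)
    {U : ℕ → Set G} (hU : ∀ n, U n ∈ nhds (0 : G)) :
    ∃ a : ℕ → List G, ∀ L : List G, ∃ n, List.Forall₂ (fun b g => g - b ∈ U n) (a n) L := by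
  choose h hh using fun n => exists_initial_zero_subset (hU n)
  obtain ⟨φ, hφ⟩ := hG h
  have hrep : ∀ k w, ∃ b : G, ∀ g : G, initialValues k g = w → initialValues k b = w := by
    intro k w
    by_cases hw : ∃ g : G, initialValues k g = w
    · exact ⟨hw.choose, fun _ _ => hw.choose_spec⟩
    · exact ⟨0, fun g hg => absurd ⟨g, hg⟩ hw⟩
  choose b hb using hrep
  refine ⟨fun n => (φ n).map (b (h n)), fun L => ?_⟩
  obtain ⟨n, hn⟩ := hφ (L.map Subtype.val) (by simp +contextual)
  refine ⟨n, ?_⟩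
  simp only
  rw [hn, List.map_map, List.map_map, List.forall₂_map_left_iff, List.forall₂_same]
  intro g _
  refine hh n _ fun i hi => ?_
  have := initialValues_eq_iff.1 (hb (h n) _ g rfl) i hi
  simp [this]

lemma rothbergerBounded_of_predicts {G : AddSubgroup (ℕ → ℤ)}
    (hG : ∀ h : ℕ → ℕ, ∃ φ, Predicts φ h G) : RothbergerBounded G := by
  intro U hU
  obtain ⟨a, ha⟩ := exists_translates hG hU
  refine ⟨fun n => (a n).headD 0, fun g => ?_⟩
  obtain ⟨n, hn⟩ := ha [g]
  obtain ⟨b, l, hb, hl, hbl⟩ := List.forall₂_cons_right_iff.1 hn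
  refine ⟨n, Set.mem_add.2 ⟨b, by simp [hbl], g - b, hb, by abel⟩⟩

lemma scheepersBounded_of_predicts {G : AddSubgroup (ℕ → ℤ)}
    (hG : ∀ h : ℕ → ℕ, ∃ φ, Predicts φ h G) : ScheepersBounded G := by
  classical
  intro U hU
  obtain ⟨a, ha⟩ := exists_translates hG hU
  refine ⟨fun n => (a n).toFinset, fun E => ?_⟩
  obtain ⟨n, hn⟩ := ha E.toList
  refine ⟨n, fun g hg => ?_⟩
  obtain ⟨i, hi, rfl⟩ := List.getElem_of_mem (Finset.mem_toList.2 hg)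
  have hi' : i < (a n).length := hn.length_eq ▸ hi
  exact Set.mem_add.2 ⟨(a n)[i], by simp, _, hn.get hi' hi, by simp⟩

lemma not_hurewiczBounded_of_unbounded {G : AddSubgroup (ℕ → ℤ)}
    (hG : ∀ f : ℕ → ℕ, ∃ g ∈ G, ∀ m, ∃ n ≥ m, (f n : ℤ) < g n) : ¬ HurewiczBounded G := by
  intro hH
  have hcont : ∀ n, Continuous fun g : G => (g : ℕ → ℤ) n := fun n =>
    (continuous_apply n).comp continuous_subtype_val
  obtain ⟨F, hF⟩ := hH (fun n => {g | (g : ℕ → ℤ) n = 0}) fun n =>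
    ((isOpen_discrete {(0 : ℤ)}).preimage (hcont n)).mem_nhds rfl
  obtain ⟨g, hg, hunb⟩ := hG fun n => (F n).sup fun x => ((x : ℕ → ℤ) n).natAbs
  obtain ⟨m, hm⟩ := Filter.eventually_atTop.1 (hF ⟨g, hg⟩)
  obtain ⟨n, hn, hlt⟩ := hunb m
  obtain ⟨a, ha, u, hu, hau⟩ := Set.mem_add.1 (hm n hn)
  have hle := Finset.le_sup (f := fun x : G => ((x : ℕ → ℤ) n).natAbs) ha
  have hgn : (a : ℕ → ℤ) n = g n := by
    have := congrFun (congrArg Subtype.val hau) n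
    simp only [mem_ofPred_eq] at hu
    simpa [hu] using this
  simp only [hgn] at hle
  omega

theorem stmt_13 (hcov : covMeager = Cardinal.continuum) :
    ∃ G : AddSubgroup (ℕ → ℤ),
      RothbergerBounded ↥G ∧ ScheepersBounded ↥G ∧ ¬ HurewiczBounded ↥G := by
  obtain ⟨G, hpred, hunb⟩ := exists_predicted_unbounded_addSubgroup hcov
  exact ⟨G, rothbergerBounded_of_predicts hpred, scheepersBounded_of_predicts hpred,
    not_hurewiczBounded_of_unbounded hunb⟩
end
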